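/- arXiv:1304.2163 — 2 statements merged into one kernel-verified Lean document; each statement's English description precedes it below -/
import Mathlib

section
/- Let k, s be positive integers with s < 2k, and consider the planar vector field X_{m,k,s}(x,y) = (y³ − x^{2k+1}, −x + m·y^{2s+1}). If m < 0, then the origin is an attractor (locally asymptotically stable) for X_{m,k,s}; if m > 0, then the origin is a repeller, i.e. an attractor for the time-reversed vector field −X_{m,k,s}. -/
open Real Filter Set

noncomputable section

/-- The generalized Bacciotti system
`X_{m,k,s}(x,y) = (y³ − x^{2k+1}, −x + m·y^{2s+1})`. -/
def genBacciotti (m : ℝ) (k s : ℕ) (p : ℝ × ℝ) : ℝ × ℝ :=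
  (p.2 ^ 3 - p.1 ^ (2 * k + 1), -p.1 + m * p.2 ^ (2 * s + 1))

/-- A forward solution of the vector field `X`, defined for all `t ≥ 0`. -/
def IsForwardSolution (X : ℝ × ℝ → ℝ × ℝ) (γ : ℝ → ℝ × ℝ) : Prop :=
  ∀ t ∈ Set.Ici (0 : ℝ), HasDerivWithinAt γ (X (γ t)) (Set.Ici (0 : ℝ)) t

/-- The origin is an attractor (locally asymptotically stable) for the planar
vector field `X`: it is Lyapunov stable, and there is a neighborhood of the
origin all of whose points have forward orbits defined for all `t ≥ 0` and
tending to the origin as `t → +∞`. -/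
def OriginIsAttractor (X : ℝ × ℝ → ℝ × ℝ) : Prop :=
  (∀ ε > (0 : ℝ), ∃ δ > (0 : ℝ), ∀ γ : ℝ → ℝ × ℝ,
      IsForwardSolution X γ → ‖γ 0‖ < δ → ∀ t ≥ (0 : ℝ), ‖γ t‖ < ε) ∧
  (∃ δ > (0 : ℝ), ∀ p : ℝ × ℝ, ‖p‖ < δ →
      ∃ γ : ℝ → ℝ × ℝ, IsForwardSolution X γ ∧ γ 0 = p ∧
        Tendsto γ atTop (nhds (0 : ℝ × ℝ)))

/-- The origin is a repeller for `X`: an attractor for the time-reversed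
vector field `−X`. -/
def OriginIsRepeller (X : ℝ × ℝ → ℝ × ℝ) : Prop :=
  OriginIsAttractor fun p => -X p

open scoped NNReal in
/-- A bounded Lipschitz vector field has forward solutions on `[0, ∞)` from every initial point. -/
lemma exists_isForwardSolution_of_lipschitz_bounded {Y : ℝ × ℝ → ℝ × ℝ} {K L : ℝ≥0}
    (hY : LipschitzWith K Y) (hL : ∀ p, ‖Y p‖ ≤ L) (p : ℝ × ℝ) :
    ∃ γ : ℝ → ℝ × ℝ, IsForwardSolution Y γ ∧ γ 0 = p := by
  have local_solution : ∀ n : ℕ, ∃ α : ℝ → ℝ × ℝ, α 0 = p ∧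
      ∀ t ∈ Icc (0 : ℝ) n, HasDerivWithinAt α (Y (α t)) (Icc (0 : ℝ) n) t := by
    intro n
    have hpl : IsPicardLindelof (fun _ => Y)
        (⟨0, le_rfl, Nat.cast_nonneg n⟩ : Icc (0 : ℝ) n) p (L * n) 0 L K :=
      { lipschitzOnWith := fun _ _ => hY.lipschitzOnWith
        continuousOn := fun _ _ => continuousOn_const
        norm_le := fun _ _ x _ => hL x
        mul_max_le := by simp }
    simpa using hpl.exists_eq_forall_mem_Icc_hasDerivWithinAt₀
  choose α hα0 hα using local_solution
  have agree : ∀ m n : ℕ, m ≤ n → EqOn (α m) (α n) (Icc 0 m) := by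
    intro m n hmn
    have hsub : Icc (0 : ℝ) m ⊆ Icc (0 : ℝ) n := Icc_subset_Icc_right (by exact_mod_cast hmn)
    refine ODE_solution_unique (v := fun _ => Y) (K := K) (fun _ => hY)
      (fun t ht => (hα m t ht).continuousWithinAt) (fun t ht => ?_)
      (fun t ht => ((hα n t (hsub ht)).mono hsub).continuousWithinAt) (fun t ht => ?_)
      (by rw [hα0, hα0])
    · exact (hα m t (Ico_subset_Icc_self ht)).mono_of_mem_nhdsWithin
        (Icc_mem_nhdsGE_of_mem ht)
    · exact ((hα n t (hsub (Ico_subset_Icc_self ht))).mono hsub).mono_of_mem_nhdsWithin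
        (Icc_mem_nhdsGE_of_mem ht)
  have glue : ∀ (n : ℕ), ∀ t ∈ Icc (0 : ℝ) n, α (⌈t⌉₊) t = α n t := fun n t ht =>
    agree _ _ (Nat.ceil_le.2 ht.2) ⟨ht.1, Nat.le_ceil t⟩
  refine ⟨fun t => α (⌈t⌉₊) t, fun t ht => ?_, by simp [hα0]⟩
  have ht0 : (0 : ℝ) ≤ t := ht
  obtain ⟨n, hn⟩ := exists_nat_gt t
  have htn : t ∈ Icc (0 : ℝ) n := ⟨ht0, hn.le⟩
  have hder := (hα n t htn).congr (fun u hu => glue n u hu) (glue n t htn)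
  have hder' : HasDerivWithinAt (fun t => α (⌈t⌉₊) t) (Y (α n t)) (Ici 0) t := by
    refine hder.mono_of_mem_nhdsWithin ?_
    filter_upwards [self_mem_nhdsWithin, mem_nhdsWithin_of_mem_nhds (Iio_mem_nhds hn)]
      with u hu hu' using ⟨hu, le_of_lt hu'⟩
  simpa only [glue n t htn] using hder'

/-- Time translates of forward solutions are forward solutions. -/
lemma IsForwardSolution.shift {Y : ℝ × ℝ → ℝ × ℝ} {γ : ℝ → ℝ × ℝ} (h : IsForwardSolution Y γ)
    {T : ℝ} (hT : 0 ≤ T) : IsForwardSolution Y fun t => γ (T + t) := by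
  intro t ht
  have ht0 : (0 : ℝ) ≤ t := ht
  have hmaps : MapsTo (fun u => T + u) (Ici (0 : ℝ)) (Ici 0) :=
    fun u hu => mem_Ici.2 (add_nonneg hT hu)
  have hder := HasDerivWithinAt.scomp t (h (T + t) (mem_Ici.2 (by positivity)))
    ((hasDerivAt_id t).const_add T).hasDerivWithinAt hmaps
  rw [one_smul] at hder
  exact hder

lemma IsForwardSolution.continuousOn {Y : ℝ × ℝ → ℝ × ℝ} {γ : ℝ → ℝ × ℝ}
    (h : IsForwardSolution Y γ) : ContinuousOn γ (Ici 0) :=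
  fun t ht => (h t ht).continuousWithinAt

/-- If the orbital derivative of `V` is at most `-c` along a forward solution on `[0, T]`,
then `V` decreases at least at rate `c` there. -/
lemma IsForwardSolution.le_sub_mul {Y : ℝ × ℝ → ℝ × ℝ} {γ : ℝ → ℝ × ℝ}
    (h : IsForwardSolution Y γ) {V : ℝ × ℝ → ℝ} (hV : Differentiable ℝ V) {c T : ℝ} (hT : 0 ≤ T)
    (hc : ∀ t ∈ Icc 0 T, fderiv ℝ V (γ t) (Y (γ t)) ≤ -c) : V (γ T) ≤ V (γ 0) - c * T := by
  have hsub : Icc 0 T ⊆ Ici 0 := Icc_subset_Ici_self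
  refine image_le_of_deriv_right_le_deriv_boundary (f := fun t => V (γ t))
    (f' := fun t => fderiv ℝ V (γ t) (Y (γ t))) (B := fun t => V (γ 0) - c * t)
    (B' := fun _ => -c) (a := 0) (b := T) ?_ ?_ (by simp) (by fun_prop) ?_
    (fun t ht => hc t (Ico_subset_Icc_self ht)) (right_mem_Icc.2 hT)
  · exact hV.continuous.comp_continuousOn (h.continuousOn.mono hsub)
  · intro t ht
    exact (hV (γ t)).hasFDerivAt.comp_hasDerivWithinAt t
      ((h t ht.1).mono (Ici_subset_Ici.2 ht.1))
  · intro t _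
    simpa using (((hasDerivAt_id t).const_mul c).const_sub (V (γ 0))).hasDerivWithinAt

/-- `V` is a strict Lyapunov function for the vector field `Y` on the closed ball of radius `r`. -/
structure IsStrictLyapunov (V : ℝ × ℝ → ℝ) (Y : ℝ × ℝ → ℝ × ℝ) (r : ℝ) : Prop where
  contDiff : ContDiff ℝ 1 V
  map_zero : V 0 = 0
  pos : ∀ p, ‖p‖ ≤ r → p ≠ 0 → 0 < V p
  fderiv_neg : ∀ p, ‖p‖ ≤ r → p ≠ 0 → fderiv ℝ V p (Y p) < 0

namespace IsStrictLyapunov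

variable {V : ℝ × ℝ → ℝ} {Y : ℝ × ℝ → ℝ × ℝ} {r : ℝ}

lemma fderiv_nonpos (h : IsStrictLyapunov V Y r) (hr : 0 < r) (p : ℝ × ℝ) (hp : ‖p‖ ≤ r) :
    fderiv ℝ V p (Y p) ≤ 0 := by
  rcases eq_or_ne p 0 with rfl | h0
  · have hmin : IsLocalMin V 0 := by
      filter_upwards [Metric.closedBall_mem_nhds (0 : ℝ × ℝ) hr] with q hq
      rcases eq_or_ne q 0 with rfl | hq0
      · exact le_rfl
      · rw [h.map_zero]
        exact (h.pos q (mem_closedBall_zero_iff.1 hq) hq0).le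
    simp [hmin.fderiv_eq_zero]
  · exact (h.fderiv_neg p hp h0).le

lemma stable (h : IsStrictLyapunov V Y r) {ε : ℝ} (hε : 0 < ε) (hεr : ε ≤ r) :
    ∃ δ > (0 : ℝ), ∀ γ : ℝ → ℝ × ℝ,
      IsForwardSolution Y γ → ‖γ 0‖ < δ → ∀ t ≥ (0 : ℝ), ‖γ t‖ < ε := by
  obtain ⟨q, hq, hqmin⟩ := (isCompact_sphere (0 : ℝ × ℝ) ε).exists_isMinOn
    (NormedSpace.sphere_nonempty.2 hε.le) h.contDiff.continuous.continuousOn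
  rw [mem_sphere_zero_iff_norm] at hq
  have hVq : 0 < V q := h.pos q (hq.trans_le hεr) (by rintro rfl; simp at hq; linarith)
  have hnear : ∀ᶠ p in nhds (0 : ℝ × ℝ), V p < V q :=
    h.contDiff.continuous.continuousAt.eventually (gt_mem_nhds (by rwa [h.map_zero]))
  obtain ⟨δ, hδ, hball⟩ := Metric.eventually_nhds_iff_ball.1 hnear
  refine ⟨min δ ε, lt_min hδ hε, fun γ hγ h0 t ht => ?_⟩
  by_contra! hexit
  have hnorm : ContinuousOn (fun u => ‖γ u‖) (Icc 0 t) :=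
    (hγ.continuousOn.mono Icc_subset_Ici_self).norm
  have hcompact : IsCompact (Icc 0 t ∩ (fun u => ‖γ u‖) ⁻¹' Ici ε) :=
    isCompact_Icc.of_isClosed_subset
      (hnorm.preimage_isClosed_of_isClosed isClosed_Icc isClosed_Ici) inter_subset_left
  obtain ⟨T, ⟨⟨hT0, hTt⟩, hTε⟩, hleast⟩ := hcompact.exists_isLeast ⟨t, ⟨ht, le_rfl⟩, hexit⟩
  have hTε' : ε ≤ ‖γ T‖ := hTε
  have hbefore : ∀ u ∈ Ico 0 T, ‖γ u‖ < ε := fun u hu => by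
    by_contra! hu'
    exact absurd (hleast ⟨⟨hu.1, hu.2.le.trans hTt⟩, hu'⟩) (not_le.2 hu.2)
  have hT_eq : ‖γ T‖ = ε := by
    obtain ⟨u, hu, hu'⟩ := intermediate_value_Icc hT0 (hnorm.mono (Icc_subset_Icc_right hTt))
      ⟨(h0.trans_le (min_le_right _ _)).le, hTε'⟩
    rcases hu.2.eq_or_lt with rfl | hlt
    · exact hu'
    · exact absurd hu' (hbefore u ⟨hu.1, hlt⟩).ne
  have hdecr := hγ.le_sub_mul (h.contDiff.differentiable one_ne_zero) (c := 0) hT0 fun u hu => by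
    rw [neg_zero]
    refine h.fderiv_nonpos (hε.trans_le hεr) _ (le_trans ?_ hεr)
    rcases hu.2.eq_or_lt with rfl | hlt
    · exact hT_eq.le
    · exact (hbefore u ⟨hu.1, hlt⟩).le
  have hlow : V q ≤ V (γ T) := hqmin (mem_sphere_zero_iff_norm.2 hT_eq)
  have hinit : V (γ 0) < V q :=
    hball _ (mem_ball_zero_iff.2 (h0.trans_le (min_le_left _ _)))
  linarith

lemma tendsto_zero (h : IsStrictLyapunov V Y r) (hr : 0 < r) (hY : Continuous Y)
    {γ : ℝ → ℝ × ℝ} (hγ : IsForwardSolution Y γ) (hball : ∀ t ≥ (0 : ℝ), ‖γ t‖ ≤ r) :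
    Tendsto γ atTop (nhds 0) := by
  rw [Metric.tendsto_atTop]
  intro ε hε
  obtain ⟨δ, hδ, hstable⟩ := h.stable (lt_min hε hr) (min_le_right ε r)
  obtain ⟨T, hT, hTδ⟩ : ∃ T ≥ (0 : ℝ), ‖γ T‖ < δ := by
    by_contra! hfar
    have hcompact : IsCompact (Metric.closedBall (0 : ℝ × ℝ) r \ Metric.ball 0 δ) :=
      (isCompact_closedBall 0 r).diff Metric.isOpen_ball
    have hmem : ∀ t ≥ (0 : ℝ), γ t ∈ Metric.closedBall (0 : ℝ × ℝ) r \ Metric.ball 0 δ :=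
      fun t ht => by simpa using ⟨hball t ht, hfar t ht⟩
    obtain ⟨q, hq, hqmax⟩ := hcompact.exists_isMaxOn (f := fun p => fderiv ℝ V p (Y p))
      ⟨_, hmem 0 le_rfl⟩
      ((h.contDiff.continuous_fderiv one_ne_zero).clm_apply hY).continuousOn
    have hq0 : q ≠ 0 := by
      rintro rfl
      exact hq.2 (Metric.mem_ball_self hδ)
    have hneg := h.fderiv_neg q (mem_closedBall_zero_iff.1 hq.1) hq0
    set c := -fderiv ℝ V q (Y q) with hc
    have hcpos : 0 < c := neg_pos.2 hneg
    obtain ⟨n, hn⟩ := exists_nat_gt (V (γ 0) / c)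
    have hdecr := hγ.le_sub_mul (h.contDiff.differentiable one_ne_zero) (c := c)
      (Nat.cast_nonneg n) fun t ht => by
        rw [hc, neg_neg]
        exact hqmax (hmem t ht.1)
    have hpos : 0 < V (γ n) := h.pos _ (hball _ (Nat.cast_nonneg n)) <| norm_pos_iff.1 <|
      hδ.trans_le (hfar _ (Nat.cast_nonneg n))
    rw [div_lt_iff₀ hcpos] at hn
    linarith
  refine ⟨T, fun t ht => ?_⟩
  have := hstable _ (hγ.shift hT) (by simpa using hTδ) (t - T) (sub_nonneg.2 ht)
  rw [dist_zero_right]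
  simpa using this.trans_le (min_le_left ε r)

/-- **Lyapunov's theorem**: a `C¹` planar vector field with a strict Lyapunov function near the
origin has the origin as an attractor. -/
theorem originIsAttractor (h : IsStrictLyapunov V Y r) (hr : 0 < r) (hY : ContDiff ℝ 1 Y) :
    OriginIsAttractor Y := by
  refine ⟨fun ε hε => ?_, ?_⟩
  · obtain ⟨δ, hδ, hstable⟩ := h.stable (lt_min hε hr) (min_le_right ε r)
    exact ⟨δ, hδ, fun γ hγ h0 t ht => (hstable γ hγ h0 t ht).trans_le (min_le_left ε r)⟩
  · set clamp : ℝ × ℝ → ℝ × ℝ := fun p => (max (-r) (min r p.1), max (-r) (min r p.2))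
    have clamp_lipschitz : LipschitzWith 1 clamp := by
      have := ((LipschitzWith.prod_fst (α := ℝ) (β := ℝ)).const_min r).const_max (-r) |>.prodMk
        (((LipschitzWith.prod_snd (α := ℝ) (β := ℝ)).const_min r).const_max (-r))
      simpa using this
    have clamp_mem : ∀ p, clamp p ∈ Metric.closedBall (0 : ℝ × ℝ) r := fun p => by
      simp only [clamp, mem_closedBall_zero_iff, Prod.norm_def, Real.norm_eq_abs, max_le_iff,
        abs_le]
      refine ⟨⟨le_max_left _ _, ?_⟩, le_max_left _ _, ?_⟩ <;>
        exact ⟨_root_.neg_le_self hr.le, min_le_left _ _⟩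
    have clamp_eq : ∀ p, ‖p‖ ≤ r → clamp p = p := fun p hp => by
      simp only [Prod.norm_def, Real.norm_eq_abs, max_le_iff, abs_le] at hp
      simp [clamp, hp]
    obtain ⟨K, hK⟩ := hY.contDiffOn.exists_lipschitzOnWith one_ne_zero
      (convex_closedBall (0 : ℝ × ℝ) r) (isCompact_closedBall 0 r)
    obtain ⟨L, hL⟩ := (isCompact_closedBall (0 : ℝ × ℝ) r).exists_bound_of_continuousOn
      hY.continuous.continuousOn
    have hYc : LipschitzWith (K * 1) (Y ∘ clamp) := lipschitzOnWith_univ.1 <|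
      hK.comp clamp_lipschitz.lipschitzOnWith fun p _ => clamp_mem p
    have hc : IsStrictLyapunov V (Y ∘ clamp) r :=
      { h with
        fderiv_neg := fun p hp h0 => by
          simpa [clamp_eq p hp] using h.fderiv_neg p hp h0 }
    obtain ⟨δ, hδ, hstable⟩ := hc.stable hr le_rfl
    refine ⟨δ, hδ, fun p hp => ?_⟩
    obtain ⟨γ, hγ, rfl⟩ := exists_isForwardSolution_of_lipschitz_bounded (L := L.toNNReal) hYc
      (fun p => (hL _ (clamp_mem p)).trans (Real.le_coe_toNNReal L)) p
    have hstay : ∀ t ≥ (0 : ℝ), ‖γ t‖ ≤ r := fun t ht => (hstable γ hγ hp t ht).le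
    refine ⟨γ, fun t ht => ?_, rfl, hc.tendsto_zero hr hYc.continuous hγ hstay⟩
    simpa [clamp_eq _ (hstay t ht)] using hγ t ht

end IsStrictLyapunov

/-- The quasi-homogeneous energy `x²/2 + y⁴/4` with the corrector `-c x^{2k+1} y`. -/
def correctedEnergy (c : ℝ) (k : ℕ) (p : ℝ × ℝ) : ℝ :=
  p.1 ^ 2 / 2 + p.2 ^ 4 / 4 - c * (p.1 ^ (2 * k + 1) * p.2)

lemma contDiff_correctedEnergy (c : ℝ) (k : ℕ) : ContDiff ℝ 1 (correctedEnergy c k) := by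
  unfold correctedEnergy
  fun_prop

lemma contDiff_genBacciotti (m : ℝ) (k s : ℕ) : ContDiff ℝ 1 (genBacciotti m k s) := by
  unfold genBacciotti
  fun_prop

lemma fderiv_correctedEnergy (c : ℝ) (k : ℕ) (p v : ℝ × ℝ) :
    fderiv ℝ (correctedEnergy c k) p v =
      (p.1 - c * ((2 * k + 1) * p.1 ^ (2 * k) * p.2)) * v.1 +
        (p.2 ^ 3 - c * p.1 ^ (2 * k + 1)) * v.2 := by
  have h1 := hasFDerivAt_fst (𝕜 := ℝ) (p := p)
  have h2 := hasFDerivAt_snd (𝕜 := ℝ) (p := p)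
  have h : HasFDerivAt (correctedEnergy c k) _ p :=
    (((h1.pow 2).mul_const (2⁻¹ : ℝ)).add ((h2.pow 4).mul_const (4⁻¹ : ℝ))).sub
      (((h1.pow (2 * k + 1)).mul h2).const_mul c)
  rw [h.fderiv]
  simp
  ring

lemma norm_le_iff_abs {p : ℝ × ℝ} {r : ℝ} : ‖p‖ ≤ r ↔ |p.1| ≤ r ∧ |p.2| ≤ r := by
  simp [Prod.norm_def]

lemma correctedEnergy_pos {c : ℝ} {k : ℕ} (hk : 0 < k) {r : ℝ} (hr1 : r ≤ 1)
    (hcr : |c| * r ≤ 1 / 4) {p : ℝ × ℝ} (hp : ‖p‖ ≤ r) (h0 : p ≠ 0) :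
    0 < correctedEnergy c k p := by
  obtain ⟨x, y⟩ := p
  obtain ⟨hx, hy⟩ := norm_le_iff_abs.1 hp
  simp only at hx hy
  obtain ⟨j, rfl⟩ : ∃ j, k = j + 1 := ⟨k - 1, by omega⟩
  have hxpow : |x| ^ (2 * j + 1) ≤ 1 := pow_le_one₀ (abs_nonneg x) (hx.trans hr1)
  have hcorr : c * (x ^ (2 * (j + 1) + 1) * y) ≤ x ^ 2 / 4 := by
    calc c * (x ^ (2 * (j + 1) + 1) * y) ≤ |c * (x ^ (2 * (j + 1) + 1) * y)| := le_abs_self _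
      _ = x ^ 2 * (|c| * |y| * |x| ^ (2 * j + 1)) := by
        rw [abs_mul, abs_mul, abs_pow, ← sq_abs x]
        ring
      _ ≤ x ^ 2 * (|c| * r * 1) := by
        have hr0 : 0 ≤ r := (abs_nonneg x).trans hx
        gcongr
      _ ≤ x ^ 2 / 4 := by nlinarith [sq_nonneg x]
  have hpos : 0 < x ^ 2 / 4 + y ^ 4 / 4 := by
    rcases eq_or_ne x 0 with rfl | hx0
    · have : y ≠ 0 := fun hy0 => h0 (by simp [hy0])
      positivity
    · positivity
  simp only [correctedEnergy]
  linarith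

lemma isStrictLyapunov_of_neg {m : ℝ} (hm : m < 0) {k : ℕ} (hk : 0 < k) (s : ℕ) :
    IsStrictLyapunov (correctedEnergy 0 k) (genBacciotti m k s) 1 where
  contDiff := contDiff_correctedEnergy 0 k
  map_zero := by simp [correctedEnergy]
  pos p hp h0 := correctedEnergy_pos hk le_rfl (by norm_num) hp h0
  fderiv_neg p _ h0 := by
    obtain ⟨x, y⟩ := p
    rw [fderiv_correctedEnergy]
    have hid : (x - 0 * ((2 * k + 1) * x ^ (2 * k) * y)) * (genBacciotti m k s (x, y)).1 +
        (y ^ 3 - 0 * x ^ (2 * k + 1)) * (genBacciotti m k s (x, y)).2 =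
        -((x ^ (k + 1)) ^ 2 + -m * (y ^ (s + 2)) ^ 2) := by
      simp only [genBacciotti]
      ring
    have hm' : 0 < -m := neg_pos.2 hm
    rw [hid, neg_lt_zero]
    rcases eq_or_ne x 0 with rfl | hx0
    · have : y ≠ 0 := fun hy0 => h0 (by simp [hy0])
      positivity
    · positivity

/-- A quasi-homogeneous Young inequality: where `y⁴ ≤ η x²` the mixed monomial is absorbed by
`x^{2k+2}`, and elsewhere by `y^{2s+4}`, which has lower weight than `y^{4k+4}`. -/
lemma pow_mul_pow_four_le {k s : ℕ} (hsk : s < 2 * k) {η r x y : ℝ} (hη : 0 < η)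
    (hr1 : r ≤ 1) (hy : |y| ≤ r) :
    x ^ (2 * k) * y ^ 4 ≤ η * (x ^ (k + 1)) ^ 2 + r / η ^ k * (y ^ (s + 2)) ^ 2 := by
  have hr0 : 0 ≤ r := (abs_nonneg y).trans hy
  rcases le_total (y ^ 4) (η * x ^ 2) with h | h
  · calc x ^ (2 * k) * y ^ 4 = (x ^ k) ^ 2 * y ^ 4 := by ring
      _ ≤ (x ^ k) ^ 2 * (η * x ^ 2) := by gcongr
      _ = η * (x ^ (k + 1)) ^ 2 := by ring
      _ ≤ _ := le_add_of_nonneg_right (by positivity)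
  · obtain ⟨d, hd⟩ : ∃ d, 2 * k = s + d + 1 := ⟨2 * k - s - 1, by omega⟩
    have hsq : x ^ 2 ≤ y ^ 4 / η := by
      rw [le_div_iff₀ hη]
      linarith
    have hyr : (|y| ^ d) ^ 2 * (|y| * |y|) ≤ 1 * (1 * r) := by
      have : |y| ≤ 1 := hy.trans hr1
      have : |y| ^ d ≤ 1 := pow_le_one₀ (abs_nonneg y) this
      gcongr
      exact pow_le_one₀ (by positivity) this
    calc x ^ (2 * k) * y ^ 4 = (x ^ 2) ^ k * y ^ 4 := by ring
      _ ≤ (y ^ 4 / η) ^ k * y ^ 4 := by gcongr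
      _ = (y ^ (2 * k)) ^ 2 * y ^ 4 / η ^ k := by rw [div_pow]; ring
      _ = ((|y| ^ d) ^ 2 * (|y| * |y|)) / η ^ k * (y ^ (s + 2)) ^ 2 := by
        rw [hd, ← abs_pow, sq_abs, abs_mul_abs_self]; ring
      _ ≤ r / η ^ k * (y ^ (s + 2)) ^ 2 := by
        gcongr
        simpa using hyr
      _ ≤ _ := le_add_of_nonneg_left (by positivity)

lemma abs_pow_mul_pow_le {k s : ℕ} (hk : 0 < k) (hs : 0 < s) {r x y : ℝ} (hr1 : r ≤ 1)
    (hx : |x| ≤ r) (hy : |y| ≤ r) :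
    2 * (x ^ (2 * k + 1) * y ^ (2 * s + 1)) ≤ r * ((x ^ (k + 1)) ^ 2 + (y ^ (s + 2)) ^ 2) := by
  have hr0 : 0 ≤ r := (abs_nonneg y).trans hy
  obtain ⟨j, rfl⟩ : ∃ j, k = j + 1 := ⟨k - 1, by omega⟩
  obtain ⟨i, rfl⟩ : ∃ i, s = i + 1 := ⟨s - 1, by omega⟩
  have hxj : |x| ^ j ≤ 1 := pow_le_one₀ (abs_nonneg x) (hx.trans hr1)
  have hyi : |y| ^ i ≤ 1 := pow_le_one₀ (abs_nonneg y) (hy.trans hr1)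
  have hfac : |x| ^ j * |x| * |y| ^ i ≤ 1 * r * 1 := by gcongr
  calc 2 * (x ^ (2 * (j + 1) + 1) * y ^ (2 * (i + 1) + 1))
      ≤ 2 * |x ^ (2 * (j + 1) + 1) * y ^ (2 * (i + 1) + 1)| := by gcongr; exact le_abs_self _
    _ = (|x| ^ j * |x| * |y| ^ i) * (2 * |x| ^ (j + 1 + 1) * |y| ^ (i + 1 + 2)) := by
      rw [abs_mul, abs_pow, abs_pow]
      ring
    _ ≤ (1 * r * 1) * ((|x| ^ (j + 1 + 1)) ^ 2 + (|y| ^ (i + 1 + 2)) ^ 2) := by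
      gcongr
      exact two_mul_le_add_sq _ _
    _ = _ := by
      rw [← abs_pow x, ← abs_pow y, sq_abs, sq_abs]
      ring

lemma neg_pow_mul_le {k : ℕ} (hk : 0 < k) {r x y : ℝ} (hr1 : r ≤ 1) (hx : |x| ≤ r)
    (hy : |y| ≤ r) : -(x ^ (4 * k + 1) * y) ≤ r * (x ^ (k + 1)) ^ 2 := by
  obtain ⟨j, rfl⟩ : ∃ j, k = j + 1 := ⟨k - 1, by omega⟩
  have hxj : |x| ^ (2 * j + 1) ≤ 1 := pow_le_one₀ (abs_nonneg x) (hx.trans hr1)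
  calc -(x ^ (4 * (j + 1) + 1) * y) ≤ |x ^ (4 * (j + 1) + 1) * y| := neg_le_abs _
    _ = |x| ^ (2 * j + 1) * |y| * (|x| ^ (j + 1 + 1)) ^ 2 := by
      rw [abs_mul, abs_pow]
      ring
    _ ≤ 1 * r * (|x| ^ (j + 1 + 1)) ^ 2 := by gcongr
    _ = _ := by rw [← abs_pow, sq_abs, one_mul]

lemma exists_isStrictLyapunov_neg_of_pos {m : ℝ} (hm : 0 < m) {k s : ℕ} (hk : 0 < k)
    (hs : 0 < s) (hsk : s < 2 * k) :
    ∃ r > (0 : ℝ), IsStrictLyapunov (correctedEnergy 2 k) (fun p => -genBacciotti m k s p) r := by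
  set N : ℝ := 2 * (2 * k + 1) with hN
  have hNpos : 0 < N := by positivity
  set η : ℝ := 1 / (8 * N) with hη
  have hηpos : 0 < η := by positivity
  have hNη : N * η = 1 / 8 := by rw [hη]; field_simp
  obtain ⟨r, hr, hr8, hrN, hrm, hrη⟩ : ∃ r > (0 : ℝ), r ≤ 1 / 8 ∧ N * r ≤ 1 / 8 ∧ m * r ≤ 1 / 8 ∧
      N / η ^ k * r ≤ m / 8 := by
    have small : ∀ a b : ℝ, 0 < b → ∀ᶠ r in nhdsWithin (0 : ℝ) (Ioi 0), a * r ≤ b := by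
      intro a b hb
      have hlim : Tendsto (fun r : ℝ => a * r) (nhds 0) (nhds 0) := by
        simpa using (continuous_const_mul a).tendsto 0
      exact nhdsWithin_le_nhds (hlim.eventually (ge_mem_nhds hb))
    obtain ⟨r, hr, h1, h2, h3, h4⟩ := ((eventually_mem_nhdsWithin (a := (0 : ℝ)) (s := Ioi 0)).and <|
      (small 1 (1 / 8) (by norm_num)).and <| (small N (1 / 8) (by norm_num)).and <|
      (small m (1 / 8) (by norm_num)).and (small (N / η ^ k) (m / 8) (by positivity))).exists
    exact ⟨r, hr, by simpa using h1, h2, h3, h4⟩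
  have hr1 : r ≤ 1 := by linarith
  refine ⟨r, hr, contDiff_correctedEnergy 2 k, by simp [correctedEnergy],
    fun p hp h0 => correctedEnergy_pos hk hr1 (by norm_num; linarith) hp h0, fun p hp h0 => ?_⟩
  obtain ⟨x, y⟩ := p
  obtain ⟨hx, hy⟩ := norm_le_iff_abs.1 hp
  simp only at hx hy
  have hmixed := pow_mul_pow_four_le (x := x) hsk hηpos hr1 hy
  have hcross := abs_pow_mul_pow_le hk hs hr1 hx hy
  have hhigh := neg_pow_mul_le hk hr1 hx hy
  set A := (x ^ (k + 1)) ^ 2 with hA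
  set B := (y ^ (s + 2)) ^ 2 with hB
  have hAnn : 0 ≤ A := sq_nonneg _
  have hBnn : 0 ≤ B := sq_nonneg _
  have hmB : 0 ≤ m * B := mul_nonneg hm.le hBnn
  have hABpos : 0 < A + m * B := by
    rcases eq_or_ne x 0 with rfl | hx0
    · have : y ≠ 0 := fun hy0 => h0 (by simp [hy0])
      positivity
    · positivity
  have hid : fderiv ℝ (correctedEnergy 2 k) (x, y) (-genBacciotti m k s (x, y)) =
      -A - m * B + m * (2 * (x ^ (2 * k + 1) * y ^ (2 * s + 1))) +
        N * (x ^ (2 * k) * y ^ 4) + N * -(x ^ (4 * k + 1) * y) := by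
    rw [fderiv_correctedEnergy]
    simp only [genBacciotti, Prod.fst_neg, Prod.snd_neg, hA, hB, hN]
    ring
  have h1 := mul_le_mul_of_nonneg_left hcross hm.le
  have h2 := mul_le_mul_of_nonneg_left hmixed hNpos.le
  have h3 := mul_le_mul_of_nonneg_left hhigh hNpos.le
  have e1 : m * (r * (A + B)) ≤ 1 / 8 * A + m / 8 * B := by
    have := mul_le_mul_of_nonneg_right hrm hAnn
    have := mul_le_mul_of_nonneg_right hr8 hmB
    linarith
  have e2 : N * (η * A + r / η ^ k * B) ≤ 1 / 8 * A + m / 8 * B := by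
    have := mul_le_mul_of_nonneg_right hrη hBnn
    calc N * (η * A + r / η ^ k * B) = N * η * A + N / η ^ k * r * B := by ring
      _ ≤ _ := by rw [hNη]; linarith
  have e3 : N * (r * A) ≤ 1 / 8 * A := by
    have := mul_le_mul_of_nonneg_right hrN hAnn
    linarith
  show fderiv ℝ (correctedEnergy 2 k) (x, y) (-genBacciotti m k s (x, y)) < 0
  rw [hid]
  linarith

theorem genBacciotti_stability_s_lt_two_k (k s : ℕ) (hk : 0 < k) (hs : 0 < s)
    (hsk : s < 2 * k) (m : ℝ) :
    (m < 0 → OriginIsAttractor (genBacciotti m k s)) ∧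
    (0 < m → OriginIsRepeller (genBacciotti m k s)) := by
  refine ⟨fun hm => (isStrictLyapunov_of_neg hm hk s).originIsAttractor one_pos
    (contDiff_genBacciotti m k s), fun hm => ?_⟩
  obtain ⟨r, hr, hV⟩ := exists_isStrictLyapunov_neg_of_pos hm hk hs hsk
  exact hV.originIsAttractor hr (contDiff_genBacciotti m k s).neg

end
end

section
/- For Bacciotti's system X_m(x,y) = (y³ − x³, −x + m·y⁵) with m = 3/5, the origin is a repeller, i.e. an attractor for the time-reversed vector field −X_{3/5}. Moreover, a Hopf-like bifurcation occurs at m = 3/5: for every neighborhood U of the origin there exists ε > 0 such that for every m ∈ (3/5 − ε, 3/5) the system X_m has a periodic orbit whose image is contained in U. -/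
open Real Filter Set

noncomputable section

/-- Bacciotti's system `X_m(x,y) = (y³ − x³, −x + m·y⁵)`. -/
def bacciotti (m : ℝ) (p : ℝ × ℝ) : ℝ × ℝ :=
  (p.2 ^ 3 - p.1 ^ 3, -p.1 + m * p.2 ^ 5)

/-- A (global) solution of Bacciotti's system. -/
def IsSolution (m : ℝ) (γ : ℝ → ℝ × ℝ) : Prop :=
  ∀ t : ℝ, HasDerivAt γ (bacciotti m (γ t)) t

/-- A periodic orbit: a nonconstant `T`-periodic solution with `T > 0`. -/
def IsPeriodicOrbit (m : ℝ) (γ : ℝ → ℝ × ℝ) (T : ℝ) : Prop :=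
  IsSolution m γ ∧ (¬ ∃ c : ℝ × ℝ, ∀ t, γ t = c) ∧ 0 < T ∧ Function.Periodic γ T

/-- The saddle point `p_m^+ = (m^{−1/4}, m^{−1/4})`. -/
def pPlus (m : ℝ) : ℝ × ℝ := (m ^ (-(1 : ℝ) / 4), m ^ (-(1 : ℝ) / 4))

/-- The saddle point `p_m^− = (−m^{−1/4}, −m^{−1/4})`. -/
def pMinus (m : ℝ) : ℝ × ℝ := (-(m ^ (-(1 : ℝ) / 4)), -(m ^ (-(1 : ℝ) / 4)))

/-- A heteroclinic connection from `p_m^−` to `p_m^+`. -/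
def IsHeteroclinic (m : ℝ) (γ : ℝ → ℝ × ℝ) : Prop :=
  IsSolution m γ ∧ Tendsto γ atBot (nhds (pMinus m)) ∧ Tendsto γ atTop (nhds (pPlus m))

/-- The divergence of Bacciotti's system: `div X_m(x,y) = −3x² + 5m·y⁴`. -/
def divBacciotti (m : ℝ) (p : ℝ × ℝ) : ℝ :=
  -3 * p.1 ^ 2 + 5 * m * p.2 ^ 4

/-- `T` is the minimal period of `γ`. -/
def IsMinimalPeriod (γ : ℝ → ℝ × ℝ) (T : ℝ) : Prop :=
  0 < T ∧ Function.Periodic γ T ∧ ∀ T' : ℝ, 0 < T' → Function.Periodic γ T' → T ≤ T'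

theorem exists_global_solution {E : Type*} [NormedAddCommGroup E] [NormedSpace ℝ E]
    [CompleteSpace E] {f : ℝ → E → E} {K L : NNReal} (hK : ∀ t, LipschitzWith K (f t))
    (hc : ∀ x, Continuous fun t => f t x) (hL : ∀ t x, ‖f t x‖ ≤ L) (x₀ : E) :
    ∃ γ : ℝ → E, γ 0 = x₀ ∧ ∀ t, HasDerivAt γ (f t (γ t)) t := by
  have key : ∀ n : ℕ, ∃ α : ℝ → E, α 0 = x₀ ∧
      ∀ t ∈ Ioo (-((n : ℝ) + 1)) (n + 1), HasDerivAt α (f t (α t)) t := by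
    intro n
    have hn : (0 : ℝ) ≤ n := n.cast_nonneg
    have h0 : (0 : ℝ) ∈ Icc (-((n : ℝ) + 1)) (n + 1) := ⟨by linarith, by linarith⟩
    have hPL : IsPicardLindelof f (⟨0, h0⟩ : Icc (-((n : ℝ) + 1)) (n + 1)) x₀
        (L * (n + 1)) 0 L K :=
      { lipschitzOnWith := fun t _ => (hK t).lipschitzOnWith
        continuousOn := fun x _ => (hc x).continuousOn
        norm_le := fun t _ x _ => hL t x
        mul_max_le := by simp }
    obtain ⟨α, h1, h2⟩ := hPL.exists_eq_forall_mem_Icc_hasDerivWithinAt₀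
    exact ⟨α, h1, fun t ht => (h2 t (Ioo_subset_Icc_self ht)).hasDerivAt (Icc_mem_nhds ht.1 ht.2)⟩
  choose α hα0 hα using key
  have agree : ∀ n k : ℕ, n ≤ k → ∀ t : ℝ, |t| < n + 1 → α n t = α k t := by
    intro n k hnk t ht
    have hnk' : (n : ℝ) ≤ k := by exact_mod_cast hnk
    have hn : (0 : ℝ) ≤ n := n.cast_nonneg
    refine ODE_solution_unique_of_mem_Ioo (v := f) (s := fun _ => univ) (K := K)
      (a := -((n : ℝ) + 1)) (b := n + 1) (t₀ := 0) (fun t _ => (hK t).lipschitzOnWith)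
      ⟨by linarith, by linarith⟩ (fun t ht => ⟨hα n t ht, trivial⟩)
      (fun t ht => ⟨hα k t ⟨by linarith [ht.1], by linarith [ht.2]⟩, trivial⟩) ?_ (abs_lt.1 ht)
    rw [hα0, hα0]
  refine ⟨fun t => α ⌈|t|⌉₊ t, by simpa using hα0 0, fun t => ?_⟩
  have hloc : ∀ s : ℝ, |s| < |t| + 1 → α ⌈|s|⌉₊ s = α (⌈|t|⌉₊ + 1) s := by
    intro s hs
    refine agree _ _ ?_ s (by linarith [Nat.le_ceil |s|])
    rw [Nat.ceil_le]
    push_cast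
    linarith [Nat.le_ceil |t|]
  have ht := hloc t (by linarith)
  have hd := hα (⌈|t|⌉₊ + 1) t (abs_lt.1 (by push_cast; linarith [Nat.le_ceil |t|]))
  simp only [ht]
  refine hd.congr_of_eventuallyEq ?_
  filter_upwards [(isOpen_lt continuous_abs continuous_const).mem_nhds
    (show |t| < |t| + 1 by linarith)] with s hs using hloc s hs

theorem exists_reparametrization {E : Type*} [NormedAddCommGroup E] [NormedSpace ℝ E]
    {X : E → E} {c : ℝ → E} {τ : ℝ → ℝ} {P τ₀ : ℝ} (hP : 0 < P) (hτ₀ : 0 < τ₀)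
    (hτ : ∀ s, τ₀ ≤ τ s) (hτc : Continuous τ) (hτP : Function.Periodic τ P)
    (hcP : Function.Periodic c P) (hc : ∀ s, HasDerivAt c (τ s • X (c s)) s) :
    ∃ (γ : ℝ → E) (T : ℝ), (∀ t, HasDerivAt γ (X (γ t)) t) ∧ 0 < T ∧ Function.Periodic γ T ∧
      range γ = range c := by
  set S : ℝ → ℝ := fun s => ∫ x in (0 : ℝ)..s, τ x with hS
  have hSd : ∀ s, HasDerivAt S (τ s) s := fun s =>
    intervalIntegral.integral_hasDerivAt_right (hτc.intervalIntegrable _ _)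
      hτc.stronglyMeasurable.stronglyMeasurableAtFilter hτc.continuousAt
  have hSc : Continuous S := continuous_iff_continuousAt.2 fun s => (hSd s).continuousAt
  have hgrow : ∀ a b, a ≤ b → τ₀ * (b - a) ≤ S b - S a := by
    intro a b hab
    refine Convex.mul_sub_le_image_sub_of_le_deriv convex_univ hSc.continuousOn
      (fun s _ => (hSd s).differentiableAt.differentiableWithinAt)
      (fun s _ => by rw [(hSd s).deriv]; exact hτ s) a trivial b trivial hab
  have hmono : StrictMono S := by
    intro a b hab
    nlinarith [hgrow a b hab.le]
  have hS0 : S 0 = 0 := by simp [hS]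
  have htop : Tendsto S atTop atTop := by
    refine tendsto_atTop_mono' atTop ?_ (tendsto_id.const_mul_atTop hτ₀)
    filter_upwards [eventually_ge_atTop 0] with s hs
    simpa [hS0] using hgrow 0 s hs
  have hbot : Tendsto S atBot atBot := by
    refine tendsto_atBot_mono' atBot ?_ (tendsto_id.const_mul_atBot hτ₀)
    filter_upwards [eventually_le_atBot 0] with s hs
    have := hgrow s 0 hs
    simp only [hS0, id] at this ⊢
    linarith
  set e := hmono.orderIsoOfSurjective S (hSc.surjective htop hbot)
  have heS : ∀ s, e s = S s := fun s => rfl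
  have hper : ∀ s, S (s + P) = S s + S P := by
    intro s
    have h := hτP.intervalIntegral_add_eq_add 0 s (fun _ _ => hτc.intervalIntegrable _ _)
    simpa [hS] using h
  have hSP : 0 < S P := by simpa [hS0] using hmono hP
  refine ⟨fun t => c (e.symm t), S P, fun t => ?_, hSP, fun t => ?_, ?_⟩
  · have h1 : HasDerivAt e.symm (τ (e.symm t))⁻¹ t :=
      HasDerivAt.of_local_left_inverse e.symm.continuous.continuousAt (hSd _)
        (hτ₀.trans_le (hτ _)).ne' (Eventually.of_forall fun y => e.apply_symm_apply y)
    have h2 := (hc (e.symm t)).scomp t h1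
    rwa [smul_smul, inv_mul_cancel₀ (hτ₀.trans_le (hτ _)).ne', one_smul] at h2
  · have : e.symm (t + S P) = e.symm t + P := by
      rw [e.symm_apply_eq, heS, hper, show S (e.symm t) = t from e.apply_symm_apply t]
    simp only [this]
    exact hcP _
  · exact e.symm.surjective.range_comp c

theorem norm_lt_of_lyapunov {Y : ℝ × ℝ → ℝ × ℝ} {W D : ℝ × ℝ → ℝ} {ρ : ℝ}
    (hWc : Continuous W) (hW0 : W 0 = 0) (hWpos : ∀ p, p ≠ 0 → ‖p‖ ≤ ρ → 0 < W p)
    (hD : ∀ p, ‖p‖ ≤ ρ → D p ≤ 0)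
    (hWD : ∀ (γ : ℝ → ℝ × ℝ) (s : Set ℝ) (t : ℝ), ‖γ t‖ ≤ ρ →
      HasDerivWithinAt γ (Y (γ t)) s t → HasDerivWithinAt (fun u => W (γ u)) (D (γ t)) s t)
    {ε : ℝ} (hε : 0 < ε) (hερ : ε ≤ ρ) :
    ∃ δ > 0, ∀ γ : ℝ → ℝ × ℝ, IsForwardSolution Y γ → ∀ t₀ ≥ 0, ‖γ t₀‖ < δ →
      ∀ t ≥ t₀, ‖γ t‖ < ε := by
  have hne : (Metric.sphere (0 : ℝ × ℝ) ε).Nonempty := NormedSpace.sphere_nonempty.2 hε.le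
  obtain ⟨q, hq, hmin⟩ := (isCompact_sphere (0 : ℝ × ℝ) ε).exists_isMinOn hne hWc.continuousOn
  have hqε : ‖q‖ = ε := by simpa using hq
  have hWq : 0 < W q := hWpos q (by rintro rfl; simp at hqε; linarith) (by linarith)
  obtain ⟨δ, hδ, hδW⟩ := Metric.mem_nhds_iff.1
    (hWc.continuousAt.preimage_mem_nhds (Iio_mem_nhds (hW0.trans_lt hWq)))
  refine ⟨min δ ε, lt_min hδ hε, fun γ hγ t₀ ht₀ hsmall t ht => ?_⟩
  by_contra! hbig
  have hcont : ContinuousOn γ (Ici 0) := fun s hs => (hγ s hs).continuousWithinAt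
  have hcont' : ContinuousOn (fun s => ‖γ s‖) (Icc t₀ t) :=
    (hcont.mono fun s hs => ht₀.le.trans hs.1).norm
  have hcomp : IsCompact (Icc t₀ t ∩ (fun s => ‖γ s‖) ⁻¹' Ici ε) :=
    isCompact_Icc.of_isClosed_subset (hcont'.preimage_isClosed_of_isClosed isClosed_Icc isClosed_Ici)
      inter_subset_left
  obtain ⟨t₁, ⟨ht₁, ht₁ε⟩, hleast⟩ := hcomp.exists_isLeast ⟨t, ⟨ht, le_rfl⟩, hbig⟩
  obtain ⟨s, hs, hsε⟩ := intermediate_value_Icc ht₁.1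
    (hcont'.mono (Icc_subset_Icc_right ht₁.2))
    (show ε ∈ Icc ‖γ t₀‖ ‖γ t₁‖ from ⟨(hsmall.trans_le (min_le_right _ _)).le, ht₁ε⟩)
  have hst : s = t₁ := le_antisymm hs.2
    (hleast ⟨⟨hs.1, hs.2.trans ht₁.2⟩, show ε ≤ ‖γ s‖ from hsε.ge⟩)
  subst hst
  have hle : ∀ r ∈ Icc t₀ s, ‖γ r‖ ≤ ε := by
    intro r hr
    rcases hr.2.eq_or_lt with rfl | hrs
    · exact hsε.le
    · by_contra! h
      exact absurd (hleast ⟨⟨hr.1, hr.2.trans ht₁.2⟩, h.le⟩) (not_le.2 hrs)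
  have hanti : AntitoneOn (fun r => W (γ r)) (Icc t₀ s) := by
    refine antitoneOn_of_hasDerivWithinAt_nonpos (convex_Icc _ _)
      (hWc.comp_continuousOn (hcont.mono fun r hr => ht₀.le.trans hr.1))
      (f' := fun r => D (γ r)) (fun r hr => ?_) (fun r hr => ?_)
    · have hr' := interior_subset hr
      exact hWD γ _ r ((hle r hr').trans hερ) ((hγ r (ht₀.le.trans hr'.1)).mono
        (interior_subset.trans fun r hr => ht₀.le.trans hr.1))
    · exact hD _ ((hle r (interior_subset hr)).trans hερ)
  have h1 := hanti (left_mem_Icc.2 ht₁.1) (right_mem_Icc.2 ht₁.1) ht₁.1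
  have h2 : W (γ t₀) < W q :=
    hδW (by simpa using hsmall.trans_le (min_le_left _ _))
  have h3 : W q ≤ W (γ s) := hmin (by simpa using hsε)
  simp only at h1
  linarith

theorem tendsto_zero_of_lyapunov {Y : ℝ × ℝ → ℝ × ℝ} {W D : ℝ × ℝ → ℝ} {ρ : ℝ} (hρ : 0 < ρ)
    (hWc : Continuous W) (hDc : Continuous D) (hW0 : W 0 = 0) (hD0 : D 0 = 0)
    (hWpos : ∀ p, p ≠ 0 → ‖p‖ ≤ ρ → 0 < W p) (hDneg : ∀ p, p ≠ 0 → ‖p‖ ≤ ρ → D p < 0)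
    (hWD : ∀ (γ : ℝ → ℝ × ℝ) (s : Set ℝ) (t : ℝ), ‖γ t‖ ≤ ρ →
      HasDerivWithinAt γ (Y (γ t)) s t → HasDerivWithinAt (fun u => W (γ u)) (D (γ t)) s t)
    {γ : ℝ → ℝ × ℝ} (hγ : IsForwardSolution Y γ) (hγρ : ∀ t ≥ 0, ‖γ t‖ ≤ ρ) :
    Tendsto γ atTop (nhds 0) := by
  have hD : ∀ p, ‖p‖ ≤ ρ → D p ≤ 0 := by
    intro p hp
    rcases eq_or_ne p 0 with rfl | h
    · exact hD0.le
    · exact (hDneg p h hp).le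
  rw [Metric.tendsto_atTop]
  intro η hη
  obtain ⟨δ, hδ, htrap⟩ := norm_lt_of_lyapunov hWc hW0 hWpos hD hWD (lt_min hη hρ)
    (min_le_right _ _)
  suffices h : ∃ T ≥ 0, ‖γ T‖ < δ by
    obtain ⟨T, hT, hTδ⟩ := h
    refine ⟨T, fun t ht => ?_⟩
    rw [dist_zero_right]
    exact (htrap γ hγ T hT hTδ t ht).trans_le (min_le_left _ _)
  by_contra! hfar
  have hK : IsCompact (Metric.closedBall (0 : ℝ × ℝ) ρ \ Metric.ball 0 δ) :=
    (isCompact_closedBall _ _).diff Metric.isOpen_ball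
  have hmem : ∀ t ≥ 0, γ t ∈ Metric.closedBall (0 : ℝ × ℝ) ρ \ Metric.ball 0 δ :=
    fun t ht => ⟨by simpa using hγρ t ht, by simpa using hfar t ht⟩
  obtain ⟨q, hq, hmax⟩ := hK.exists_isMaxOn ⟨_, hmem 0 le_rfl⟩ hDc.continuousOn
  have hne : ∀ p ∈ Metric.closedBall (0 : ℝ × ℝ) ρ \ Metric.ball 0 δ, p ≠ 0 := by
    rintro p hp rfl
    exact hp.2 (by simpa using hδ)
  have hc : D q < 0 := hDneg q (hne q hq) (by simpa using hq.1)
  have hcont : ContinuousOn γ (Ici 0) := fun s hs => (hγ s hs).continuousWithinAt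
  have hanti : AntitoneOn (fun r => W (γ r) - D q * r) (Ici 0) := by
    refine antitoneOn_of_hasDerivWithinAt_nonpos (convex_Ici _)
      ((hWc.comp_continuousOn hcont).sub (by fun_prop))
      (f' := fun r => D (γ r) - D q * 1) (fun r hr => ?_) (fun r hr => ?_)
    · have hr' := interior_subset hr
      exact (hWD γ _ r (hγρ r hr') ((hγ r hr').mono interior_subset)).sub
        ((hasDerivWithinAt_id _ _).const_mul _)
    · have := hmax (hmem r (interior_subset hr))
      simp only [mem_ofPred_eq] at this
      linarith
  have hpos : ∀ t ≥ 0, 0 < W (γ t) := fun t ht => hWpos _ (hne _ (hmem t ht)) (hγρ t ht)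
  have h0 := hpos 0 le_rfl
  have hT : 0 ≤ W (γ 0) / -D q := div_nonneg h0.le (by linarith)
  have h1 := hanti (mem_Ici.2 le_rfl) (mem_Ici.2 hT) hT
  have h2 := hpos _ hT
  have h3 : D q * (W (γ 0) / -D q) = -W (γ 0) := by
    have := hc.ne
    field_simp
  simp only [h3] at h1
  linarith

theorem originIsAttractor_of_lyapunov {Y : ℝ × ℝ → ℝ × ℝ} {W D : ℝ × ℝ → ℝ} {ρ : ℝ}
    (hρ : 0 < ρ) (hY : ContDiff ℝ 1 Y)
    (hWc : Continuous W) (hDc : Continuous D) (hW0 : W 0 = 0) (hD0 : D 0 = 0)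
    (hWpos : ∀ p, p ≠ 0 → ‖p‖ ≤ ρ → 0 < W p) (hDneg : ∀ p, p ≠ 0 → ‖p‖ ≤ ρ → D p < 0)
    (hWD : ∀ (γ : ℝ → ℝ × ℝ) (s : Set ℝ) (t : ℝ),
      HasDerivWithinAt γ (Y (γ t)) s t → HasDerivWithinAt (fun u => W (γ u)) (D (γ t)) s t) :
    OriginIsAttractor Y := by
  have hD : ∀ p, ‖p‖ ≤ ρ → D p ≤ 0 := by
    intro p hp
    rcases eq_or_ne p 0 with rfl | h
    · exact hD0.le
    · exact (hDneg p h hp).le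
  constructor
  · intro ε hε
    obtain ⟨δ, hδ, h⟩ := norm_lt_of_lyapunov hWc hW0 hWpos hD (fun γ s t _ => hWD γ s t)
      (lt_min hε hρ) (min_le_right _ _)
    exact ⟨δ, hδ, fun γ hγ h0 t ht =>
      (h γ hγ 0 le_rfl h0 t ht).trans_le (min_le_left _ _)⟩
  · set clamp : ℝ × ℝ → ℝ × ℝ := fun p => (max (-ρ) (min ρ p.1), max (-ρ) (min ρ p.2))
    have hclampL : LipschitzWith 1 clamp := by
      have h := ((LipschitzWith.prod_fst (α := ℝ) (β := ℝ)).const_min ρ).const_max (-ρ)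
      have h' := ((LipschitzWith.prod_snd (α := ℝ) (β := ℝ)).const_min ρ).const_max (-ρ)
      simpa using h.prodMk h'
    have hclamp : ∀ p, clamp p ∈ Metric.closedBall (0 : ℝ × ℝ) ρ := by
      intro p
      have h : ∀ r : ℝ, |max (-ρ) (min ρ r)| ≤ ρ := fun r =>
        abs_le.2 ⟨le_max_left _ _, max_le (neg_le_self hρ.le) (min_le_left _ _)⟩
      rw [mem_closedBall_zero_iff]
      exact max_le (h p.1) (h p.2)
    have hclampid : ∀ p, ‖p‖ ≤ ρ → clamp p = p := by
      intro p hp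
      simp only [Prod.norm_def, Real.norm_eq_abs, max_le_iff, abs_le] at hp
      simp only [clamp]
      rw [min_eq_right hp.1.2, min_eq_right hp.2.2, max_eq_right hp.1.1, max_eq_right hp.2.1]
    obtain ⟨K, hK⟩ := hY.contDiffOn.exists_lipschitzOnWith one_ne_zero
      (convex_closedBall (0 : ℝ × ℝ) ρ) (isCompact_closedBall _ _)
    have hYL : LipschitzWith (K * 1) (fun p => Y (clamp p)) := by
      rw [← lipschitzOnWith_univ]
      exact hK.comp hclampL.lipschitzOnWith fun p _ => hclamp p
    obtain ⟨L, hL⟩ := (isCompact_closedBall (0 : ℝ × ℝ) ρ).exists_bound_of_continuousOn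
      hY.continuous.continuousOn
    have hWD' : ∀ (γ : ℝ → ℝ × ℝ) (s : Set ℝ) (t : ℝ), ‖γ t‖ ≤ ρ →
        HasDerivWithinAt γ (Y (clamp (γ t))) s t →
        HasDerivWithinAt (fun u => W (γ u)) (D (γ t)) s t := by
      intro γ s t h1 h2
      rw [hclampid _ h1] at h2
      exact hWD γ s t h2
    obtain ⟨δ, hδ, htrap⟩ := norm_lt_of_lyapunov (Y := fun p => Y (clamp p)) hWc hW0 hWpos hD hWD' hρ le_rfl
    refine ⟨δ, hδ, fun p hp => ?_⟩
    obtain ⟨γ, hγ0, hγ⟩ := exists_global_solution (f := fun _ p => Y (clamp p)) (L := L.toNNReal)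
      (fun _ => hYL) (fun _ => continuous_const)
      (fun _ p => (hL _ (hclamp p)).trans (Real.le_coe_toNNReal L)) p
    have hfs : IsForwardSolution (fun p => Y (clamp p)) γ := fun t _ => (hγ t).hasDerivWithinAt
    have hγρ : ∀ t ≥ 0, ‖γ t‖ ≤ ρ := fun t ht =>
      (htrap γ hfs 0 le_rfl (by rwa [hγ0]) t ht).le
    refine ⟨γ, fun t ht => ?_, hγ0,
      tendsto_zero_of_lyapunov (Y := fun p => Y (clamp p)) hρ hWc hDc hW0 hD0 hWpos hDneg hWD' hfs hγρ⟩
    have := hfs t ht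
    simpa only [hclampid _ (hγρ t ht)] using this

/-- A Lyapunov function for Bacciotti's system at `m = 3/5`. -/
def lyap (p : ℝ × ℝ) : ℝ :=
  p.1 ^ 2 / 2 + p.2 ^ 4 / 4 - p.1 ^ 3 * p.2 - 3 / 5 * (p.1 * p.2 ^ 5) + 3 / 2 * (p.1 ^ 4 * p.2 ^ 2)
    + p.1 ^ 2 * p.2 ^ 6 + p.2 ^ 10 / 50 - 51 / 25 * (p.1 ^ 5 * p.2 ^ 3)
    - 3 / 2 * (p.1 ^ 3 * p.2 ^ 7) - 1 / 10 * (p.1 * p.2 ^ 11) - p.1 ^ 7 * p.2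

/-- The partial derivative of `lyap` in the first variable. -/
def lyapFst (p : ℝ × ℝ) : ℝ :=
  p.1 - 3 * p.1 ^ 2 * p.2 - 3 / 5 * p.2 ^ 5 + 6 * p.1 ^ 3 * p.2 ^ 2 + 2 * p.1 * p.2 ^ 6
    - 51 / 5 * p.1 ^ 4 * p.2 ^ 3 - 9 / 2 * p.1 ^ 2 * p.2 ^ 7 - 1 / 10 * p.2 ^ 11
    - 7 * p.1 ^ 6 * p.2

/-- The partial derivative of `lyap` in the second variable. -/
def lyapSnd (p : ℝ × ℝ) : ℝ :=
  p.2 ^ 3 - p.1 ^ 3 - 3 * p.1 * p.2 ^ 4 + 3 * p.1 ^ 4 * p.2 + 6 * p.1 ^ 2 * p.2 ^ 5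
    + 1 / 5 * p.2 ^ 9 - 153 / 25 * p.1 ^ 5 * p.2 ^ 2 - 21 / 2 * p.1 ^ 3 * p.2 ^ 6
    - 11 / 10 * p.1 * p.2 ^ 10 - p.1 ^ 7

/-- The derivative of `lyap` along Bacciotti's system. -/
def lyapDot (m : ℝ) (p : ℝ × ℝ) : ℝ :=
  lyapFst p * (bacciotti m p).1 + lyapSnd p * (bacciotti m p).2

theorem continuous_lyapDot (m : ℝ) : Continuous (lyapDot m) := by
  unfold lyapDot lyapFst lyapSnd bacciotti
  fun_prop

theorem hasDerivWithinAt_lyap {γ : ℝ → ℝ × ℝ} {v : ℝ × ℝ} {s : Set ℝ} {t : ℝ}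
    (h : HasDerivWithinAt γ v s t) :
    HasDerivWithinAt (fun u => lyap (γ u)) (lyapFst (γ t) * v.1 + lyapSnd (γ t) * v.2) s t := by
  have hx : HasDerivWithinAt (fun u => (γ u).1) v.1 s t := h.fst
  have hy : HasDerivWithinAt (fun u => (γ u).2) v.2 s t := h.snd
  have := (((((((((((hx.pow 2).div_const 2).add ((hy.pow 4).div_const 4)).sub
    ((hx.pow 3).mul hy)).sub ((hx.mul (hy.pow 5)).const_mul (3 / 5))).add
    (((hx.pow 4).mul (hy.pow 2)).const_mul (3 / 2))).add ((hx.pow 2).mul (hy.pow 6))).add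
    ((hy.pow 10).div_const 50)).sub (((hx.pow 5).mul (hy.pow 3)).const_mul (51 / 25))).sub
    (((hx.pow 3).mul (hy.pow 7)).const_mul (3 / 2))).sub
    ((hx.mul (hy.pow 11)).const_mul (1 / 10))).sub ((hx.pow 7).mul hy)
  refine this.congr_deriv ?_
  simp only [lyapFst, lyapSnd, Pi.pow_apply]
  push_cast
  ring

theorem lyap_pos {p : ℝ × ℝ} (hp : p ≠ 0) (hx : |p.1| ≤ 1 / 100) (hy : |p.2| ≤ 1 / 100) :
    0 < lyap p := by
  obtain ⟨x, y⟩ := p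
  simp only at hx hy
  have hxy : |x * y| ≤ 1 / 10000 := by
    rw [abs_mul]
    calc |x| * |y| ≤ 1 / 100 * (1 / 100) := by gcongr
      _ = 1 / 10000 := by norm_num
  have hy1 := abs_le.1 hy
  have hx1 := abs_le.1 hx
  have hxy1 := abs_le.1 hxy
  have hxx : x ^ 2 ≤ 1 / 10000 := by nlinarith
  have hyy : y ^ 2 ≤ 1 / 10000 := by nlinarith
  have e : lyap (x, y) = x ^ 2 * (1 / 4 - x * y - x ^ 2 * x ^ 2 * (x * y)
        + 3 / 2 * (x ^ 2 * y ^ 2) - 51 / 25 * (x * y) * (x ^ 2 * y ^ 2)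
        - 3 / 2 * (x * y) * (y ^ 2 * y ^ 2 * y ^ 2) + y ^ 6)
      + (x / 2 - 3 / 5 * y ^ 5 - 1 / 10 * y ^ 11) ^ 2
      + y ^ 4 * (1 / 4 - 9 / 25 * y ^ 6 - 3 / 25 * y ^ 12 - 1 / 100 * y ^ 18 + y ^ 6 / 50) := by
    simp only [lyap]
    ring
  have hX : 0 ≤ x ^ 2 := sq_nonneg x
  have hY : 0 ≤ y ^ 2 := sq_nonneg y
  have hy6 : y ^ 6 ≤ 1 / 10000 := by
    calc y ^ 6 = (y ^ 2) ^ 3 := by ring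
      _ ≤ (1 / 10000) ^ 3 := by gcongr
      _ ≤ _ := by norm_num
  have hy12 : y ^ 12 ≤ 1 / 10000 := by
    calc y ^ 12 = (y ^ 2) ^ 6 := by ring
      _ ≤ (1 / 10000) ^ 6 := by gcongr
      _ ≤ _ := by norm_num
  have hy18 : y ^ 18 ≤ 1 / 10000 := by
    calc y ^ 18 = (y ^ 2) ^ 9 := by ring
      _ ≤ (1 / 10000) ^ 9 := by gcongr
      _ ≤ _ := by norm_num
  have small : ∀ a b : ℝ, |a| ≤ 1 / 10000 → |b| ≤ 1 / 10000 → |a * b| ≤ 1 / 10000 := by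
    intro a b ha hb
    rw [abs_mul]
    nlinarith [abs_nonneg a, abs_nonneg b]
  have hX' : |x ^ 2| ≤ 1 / 10000 := by rwa [abs_of_nonneg hX]
  have hY' : |y ^ 2| ≤ 1 / 10000 := by rwa [abs_of_nonneg hY]
  have b1 := abs_le.1 (small _ _ (small _ _ hX' hX') hxy)
  have b2 := abs_le.1 (small _ _ hxy (small _ _ hX' hY'))
  have b3 := abs_le.1 (small _ _ hxy (small _ _ (small _ _ hY' hY') hY'))
  have h0 : 0 ≤ x ^ 2 * y ^ 2 := by positivity
  have h6 : 0 ≤ y ^ 6 := by positivity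
  have f1 : 0 < 1 / 4 - x * y - x ^ 2 * x ^ 2 * (x * y)
        + 3 / 2 * (x ^ 2 * y ^ 2) - 51 / 25 * (x * y) * (x ^ 2 * y ^ 2)
        - 3 / 2 * (x * y) * (y ^ 2 * y ^ 2 * y ^ 2) + y ^ 6 := by
    linarith [b1.1, b1.2, b2.1, b2.2, b3.1, b3.2, hxy1.1, hxy1.2]
  have f2 : 0 < 1 / 4 - 9 / 25 * y ^ 6 - 3 / 25 * y ^ 12 - 1 / 100 * y ^ 18 + y ^ 6 / 50 := by
    linarith
  rw [e]
  rcases eq_or_ne x 0 with rfl | hx0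
  · have hy0 : y ≠ 0 := by rintro rfl; exact hp rfl
    have := mul_pos (by positivity : 0 < y ^ 4) f2
    have h2 := sq_nonneg (0 / 2 - 3 / 5 * y ^ 5 - 1 / 10 * y ^ 11)
    linarith
  · have h1 := mul_pos (by positivity : 0 < x ^ 2) f1
    have h2 := mul_nonneg (by positivity : 0 ≤ y ^ 4) f2.le
    have h3 := sq_nonneg (x / 2 - 3 / 5 * y ^ 5 - 1 / 10 * y ^ 11)
    linarith

theorem lyapDot_pos {p : ℝ × ℝ} (hp : p ≠ 0) (hx : |p.1| ≤ 1 / 100) (hy : |p.2| ≤ 1 / 100) :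
    0 < lyapDot (3 / 5) p := by
  obtain ⟨x, y⟩ := p
  simp only at hx hy
  have hxy : |x * y| ≤ 1 / 10000 := by
    rw [abs_mul]
    calc |x| * |y| ≤ 1 / 100 * (1 / 100) := by gcongr
      _ = 1 / 10000 := by norm_num
  obtain ⟨hy1, hy2⟩ := abs_le.1 hy
  obtain ⟨h1, h2⟩ := abs_le.1 hxy
  have hyy : y ^ 2 ≤ 1 / 10000 := by nlinarith
  have e : lyapDot (3 / 5) (x, y) =
      x ^ 6 * y ^ 2 * (3 / 25 + 51 / 5 * (x * y) - 7 * y ^ 2 - 3 / 5 * (x * y * y ^ 2))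
      + x ^ 4 * y ^ 6 * (1 / 10 + 207 / 250 * (x * y)) + x ^ 2 * y ^ 10 * (1 / 5 - 31 / 5 * (x * y))
      + y ^ 14 * (1 / 50 - 33 / 50 * (x * y)) + x ^ 8 * (1 + 7 * (x * y)) := by
    simp only [lyapDot, lyapFst, lyapSnd, bacciotti]
    ring
  have f1 : 0 < 3 / 25 + 51 / 5 * (x * y) - 7 * y ^ 2 - 3 / 5 * (x * y * y ^ 2) := by
    nlinarith [sq_nonneg y]
  have f2 : 0 < 1 / 10 + 207 / 250 * (x * y) := by linarith
  have f3 : 0 < 1 / 5 - 31 / 5 * (x * y) := by linarith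
  have f4 : 0 < 1 / 50 - 33 / 50 * (x * y) := by linarith
  have f5 : 0 < 1 + 7 * (x * y) := by linarith
  have g1 := mul_nonneg (by positivity : 0 ≤ x ^ 6 * y ^ 2) f1.le
  have g2 := mul_nonneg (by positivity : 0 ≤ x ^ 4 * y ^ 6) f2.le
  have g3 := mul_nonneg (by positivity : 0 ≤ x ^ 2 * y ^ 10) f3.le
  rw [e]
  rcases eq_or_ne x 0 with rfl | hx0
  · have hy0 : y ≠ 0 := by rintro rfl; exact hp rfl
    have := mul_pos (by positivity : 0 < y ^ 14) f4
    linarith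
  · have g4 := mul_nonneg (by positivity : 0 ≤ y ^ 14) f4.le
    have := mul_pos (by positivity : 0 < x ^ 8) f5
    linarith

theorem abs_le_of_norm_le {p : ℝ × ℝ} {r : ℝ} (h : ‖p‖ ≤ r) : |p.1| ≤ r ∧ |p.2| ≤ r := by
  simpa [Prod.norm_def] using h

theorem originIsRepeller_bacciotti : OriginIsRepeller (bacciotti (3 / 5)) := by
  refine originIsAttractor_of_lyapunov (W := lyap) (D := fun p => -lyapDot (3 / 5) p)
    (ρ := 1 / 100) (by norm_num) ?_ ?_ (continuous_lyapDot _).neg ?_ ?_ ?_ ?_ ?_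
  · unfold bacciotti
    fun_prop
  · unfold lyap
    fun_prop
  · simp [lyap]
  · simp [lyapDot, lyapFst, lyapSnd]
  · exact fun p hp h => lyap_pos hp (abs_le_of_norm_le h).1 (abs_le_of_norm_le h).2
  · exact fun p hp h => neg_neg_of_pos
      (lyapDot_pos hp (abs_le_of_norm_le h).1 (abs_le_of_norm_le h).2)
  · intro γ s t h
    refine (hasDerivWithinAt_lyap h).congr_deriv ?_
    simp only [lyapDot, Prod.fst_neg, Prod.snd_neg]
    ring

/-- The point with quasi-homogeneous polar coordinates `(exp u, ψ)`. -/
def quasiPolar (u ψ : ℝ) : ℝ × ℝ := (exp u ^ 2 * sin ψ, exp u * cos ψ)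

/-- Numerator of the logarithmic radial rate of Bacciotti's system in quasi-homogeneous polar
coordinates, with `z` the cube of the radius. -/
def rateNum (m ψ z : ℝ) : ℝ :=
  -(cos ψ * sin ψ ^ 3) + z * (m * cos ψ ^ 6 - sin ψ ^ 4)

/-- Denominator of the logarithmic radial rate, proportional to the angular speed. -/
def rateDen (m ψ z : ℝ) : ℝ :=
  1 + sin ψ ^ 4 - z * (cos ψ * sin ψ * (2 * m * cos ψ ^ 4 + sin ψ ^ 2))

/-- The derivative of time with respect to the angle. -/
def timeRate (m u ψ : ℝ) : ℝ := (1 + sin ψ ^ 2) / (exp u * rateDen m ψ (exp u ^ 3))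

theorem abs_pow_mul_pow_le_one {a b : ℝ} (ha : |a| ≤ 1) (hb : |b| ≤ 1) (i j : ℕ) :
    |a ^ i * b ^ j| ≤ 1 := by
  rw [abs_mul, abs_pow, abs_pow]
  exact mul_le_one₀ (pow_le_one₀ (abs_nonneg _) ha) (by positivity)
    (pow_le_one₀ (abs_nonneg _) hb)

theorem abs_rateNum_coeff_le {m : ℝ} (hm0 : 0 ≤ m) (hm1 : m ≤ 1) (ψ : ℝ) :
    |m * cos ψ ^ 6 - sin ψ ^ 4| ≤ 1 := by
  have h1 := abs_le.1 (abs_pow_mul_pow_le_one (abs_cos_le_one ψ) (abs_sin_le_one ψ) 6 0)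
  have h2 := abs_le.1 (abs_pow_mul_pow_le_one (abs_cos_le_one ψ) (abs_sin_le_one ψ) 0 4)
  have h3 : 0 ≤ cos ψ ^ 6 := by positivity
  have h4 : 0 ≤ sin ψ ^ 4 := by positivity
  simp only [pow_zero, mul_one, one_mul] at h1 h2
  rw [abs_le]
  constructor <;> nlinarith

theorem abs_rateDen_coeff_le {m : ℝ} (hm0 : 0 ≤ m) (hm1 : m ≤ 1) (ψ : ℝ) :
    |cos ψ * sin ψ * (2 * m * cos ψ ^ 4 + sin ψ ^ 2)| ≤ 3 := by
  have h1 := abs_pow_mul_pow_le_one (abs_cos_le_one ψ) (abs_sin_le_one ψ) 5 1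
  have h2 := abs_pow_mul_pow_le_one (abs_cos_le_one ψ) (abs_sin_le_one ψ) 1 3
  have e : cos ψ * sin ψ * (2 * m * cos ψ ^ 4 + sin ψ ^ 2)
      = 2 * m * (cos ψ ^ 5 * sin ψ ^ 1) + cos ψ ^ 1 * sin ψ ^ 3 := by ring
  rw [e]
  refine (abs_add_le _ _).trans ?_
  rw [abs_mul, abs_of_nonneg (by positivity : 0 ≤ 2 * m)]
  nlinarith [abs_nonneg (cos ψ ^ 5 * sin ψ ^ 1)]

theorem abs_rateNum_le {m z : ℝ} (hm0 : 0 ≤ m) (hm1 : m ≤ 1) (hz0 : 0 ≤ z) (hz1 : z ≤ 1 / 8)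
    (ψ : ℝ) : |rateNum m ψ z| ≤ 2 := by
  have h1 := abs_le.1 (abs_pow_mul_pow_le_one (abs_cos_le_one ψ) (abs_sin_le_one ψ) 1 3)
  have h2 := abs_le.1 (abs_rateNum_coeff_le hm0 hm1 ψ)
  simp only [pow_one] at h1
  rw [rateNum, abs_le]
  constructor <;> nlinarith

theorem half_le_rateDen {m z : ℝ} (hm0 : 0 ≤ m) (hm1 : m ≤ 1) (hz0 : 0 ≤ z) (hz1 : z ≤ 1 / 8)
    (ψ : ℝ) : 1 / 2 ≤ rateDen m ψ z := by
  have h2 := abs_le.1 (abs_rateDen_coeff_le hm0 hm1 ψ)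
  have h3 : 0 ≤ sin ψ ^ 4 := by positivity
  rw [rateDen]
  nlinarith

theorem rateDen_le {m z : ℝ} (hm0 : 0 ≤ m) (hm1 : m ≤ 1) (hz0 : 0 ≤ z) (hz1 : z ≤ 1 / 8)
    (ψ : ℝ) : rateDen m ψ z ≤ 3 := by
  have h2 := abs_le.1 (abs_rateDen_coeff_le hm0 hm1 ψ)
  have h1 := abs_le.1 (abs_pow_mul_pow_le_one (abs_cos_le_one ψ) (abs_sin_le_one ψ) 0 4)
  simp only [pow_zero, one_mul] at h1
  rw [rateDen]
  nlinarith

theorem abs_rate_le {m z : ℝ} (hm0 : 0 ≤ m) (hm1 : m ≤ 1) (hz0 : 0 ≤ z) (hz1 : z ≤ 1 / 8)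
    (ψ : ℝ) : |rateNum m ψ z / rateDen m ψ z| ≤ 4 := by
  have h1 := abs_rateNum_le hm0 hm1 hz0 hz1 ψ
  have h2 := half_le_rateDen hm0 hm1 hz0 hz1 ψ
  rw [abs_div, abs_of_pos (by linarith : 0 < rateDen m ψ z), div_le_iff₀ (by linarith)]
  linarith

theorem abs_rate_sub_rate_le {m z w : ℝ} (hm0 : 0 ≤ m) (hm1 : m ≤ 1) (hz0 : 0 ≤ z)
    (hz1 : z ≤ 1 / 8) (hw0 : 0 ≤ w) (hw1 : w ≤ 1 / 8) (ψ : ℝ) :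
    |rateNum m ψ z / rateDen m ψ z - rateNum m ψ w / rateDen m ψ w| ≤ 20 * |z - w| := by
  have h1 := half_le_rateDen hm0 hm1 hz0 hz1 ψ
  have h2 := half_le_rateDen hm0 hm1 hw0 hw1 ψ
  have hB := abs_rateNum_coeff_le hm0 hm1 ψ
  have hF := abs_rateDen_coeff_le hm0 hm1 ψ
  have hA := abs_pow_mul_pow_le_one (abs_cos_le_one ψ) (abs_sin_le_one ψ) 1 3
  have hE := abs_le.1 (abs_pow_mul_pow_le_one (abs_cos_le_one ψ) (abs_sin_le_one ψ) 0 4)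
  have hE0 : 0 ≤ sin ψ ^ 4 := by positivity
  simp only [pow_zero, one_mul, pow_one] at hE hA
  have key : rateNum m ψ z * rateDen m ψ w - rateDen m ψ z * rateNum m ψ w
      = (z - w) * ((m * cos ψ ^ 6 - sin ψ ^ 4) * (1 + sin ψ ^ 4)
        - cos ψ * sin ψ ^ 3 * (cos ψ * sin ψ * (2 * m * cos ψ ^ 4 + sin ψ ^ 2))) := by
    rw [rateNum, rateNum, rateDen, rateDen]
    ring
  have hbound : |(m * cos ψ ^ 6 - sin ψ ^ 4) * (1 + sin ψ ^ 4)
        - cos ψ * sin ψ ^ 3 * (cos ψ * sin ψ * (2 * m * cos ψ ^ 4 + sin ψ ^ 2))| ≤ 5 := by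
    refine (abs_sub _ _).trans ?_
    rw [abs_mul, abs_mul (cos ψ * sin ψ ^ 3), abs_of_pos (by linarith : 0 < 1 + sin ψ ^ 4)]
    have i1 := mul_le_mul hB (by linarith : 1 + sin ψ ^ 4 ≤ 2) (by linarith) zero_le_one
    have i2 := mul_le_mul hA hF (abs_nonneg _) zero_le_one
    linarith
  rw [div_sub_div _ _ (by linarith) (by linarith), key, abs_div, abs_mul,
    abs_of_pos (mul_pos (by linarith) (by linarith) : 0 < rateDen m ψ z * rateDen m ψ w),
    div_le_iff₀ (mul_pos (by linarith) (by linarith))]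
  have h3 : 1 / 4 ≤ rateDen m ψ z * rateDen m ψ w := by nlinarith
  nlinarith [abs_nonneg (z - w), mul_le_mul_of_nonneg_left hbound (abs_nonneg (z - w)),
    mul_le_mul_of_nonneg_left h3 (abs_nonneg (z - w))]

theorem exp_pow_three_le {u : ℝ} (hu : u ≤ -1) : exp u ^ 3 ≤ 1 / 8 := by
  have h : exp u ≤ 1 / 2 := by
    have h1 : exp u ≤ exp (-1) := exp_le_exp.2 hu
    have h2 := add_one_le_exp (1 : ℝ)
    have h3 : exp (-1) * exp 1 = 1 := by rw [← exp_add]; simp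
    nlinarith [exp_pos (-1)]
  calc exp u ^ 3 ≤ (1 / 2) ^ 3 := by gcongr
    _ = 1 / 8 := by norm_num

theorem abs_exp_sub_exp_le {a b : ℝ} (ha : a ≤ 0) (hb : b ≤ 0) : |exp a - exp b| ≤ |a - b| := by
  wlog hab : b ≤ a generalizing a b
  · rw [abs_sub_comm, abs_sub_comm a]
    exact this hb ha (le_of_not_ge hab)
  rw [abs_of_nonneg (sub_nonneg.2 (exp_le_exp.2 hab)), abs_of_nonneg (sub_nonneg.2 hab)]
  have h1 : exp b = exp a * exp (b - a) := by rw [← exp_add]; ring_nf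
  have h2 := add_one_le_exp (b - a)
  have h3 : exp a ≤ 1 := exp_le_one_iff.2 ha
  nlinarith [exp_pos a]

theorem hasDerivAt_quasiPolar {m ψ : ℝ} {u : ℝ → ℝ} (hden : rateDen m ψ (exp (u ψ) ^ 3) ≠ 0)
    (hu : HasDerivAt u (rateNum m ψ (exp (u ψ) ^ 3) / rateDen m ψ (exp (u ψ) ^ 3)) ψ) :
    HasDerivAt (fun s => quasiPolar (u s) s)
      (timeRate m (u ψ) ψ • bacciotti m (quasiPolar (u ψ) ψ)) ψ := by
  have hr := hu.exp
  have hx := (hr.pow 2).mul (hasDerivAt_sin ψ)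
  have hy := hr.mul (hasDerivAt_cos ψ)
  refine (hx.prodMk hy).congr_deriv ?_
  have h := sin_sq_add_cos_sq ψ
  have hpos := (exp_pos (u ψ)).ne'
  rw [timeRate]
  set D := rateDen m ψ (exp (u ψ) ^ 3) with hD
  set N := rateNum m ψ (exp (u ψ) ^ 3) with hN
  rw [rateDen] at hD
  rw [rateNum] at hN
  ext
  · simp only [bacciotti, quasiPolar, Prod.smul_fst, smul_eq_mul, Pi.pow_apply]
    field_simp
    rw [hD, hN]
    push_cast
    linear_combination (-exp (u ψ) * (cos ψ * (1 + sin ψ ^ 2) + exp (u ψ) ^ 3 * sin ψ ^ 3)) * h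
  · simp only [bacciotti, quasiPolar, Prod.smul_snd, smul_eq_mul]
    field_simp
    rw [hD, hN]
    linear_combination (exp (u ψ) ^ 3 * m * cos ψ ^ 5 - sin ψ ^ 3) * h

theorem quasiPolar_add_two_pi (u ψ : ℝ) : quasiPolar u (ψ + 2 * π) = quasiPolar u ψ := by
  simp [quasiPolar]

theorem rate_add_pi (m ψ z : ℝ) :
    rateNum m (ψ + π) z / rateDen m (ψ + π) z = rateNum m ψ z / rateDen m ψ z := by
  simp only [rateNum, rateDen, sin_add_pi, cos_add_pi]
  ring

theorem exists_isPeriodicOrbit_of_periodic {m U : ℝ} {u : ℝ → ℝ} (hm0 : 0 ≤ m) (hm1 : m ≤ 1)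
    (hU : U ≤ -1) (huU : ∀ ψ, u ψ ≤ U) (hper : Function.Periodic u π)
    (hu : ∀ ψ, HasDerivAt u (rateNum m ψ (exp (u ψ) ^ 3) / rateDen m ψ (exp (u ψ) ^ 3)) ψ) :
    ∃ γ T, IsPeriodicOrbit m γ T ∧ range γ ⊆ range fun ψ => quasiPolar (u ψ) ψ := by
  have hz : ∀ ψ, exp (u ψ) ^ 3 ≤ 1 / 8 := fun ψ => exp_pow_three_le ((huU ψ).trans hU)
  have hz0 : ∀ ψ, 0 ≤ exp (u ψ) ^ 3 := fun ψ => by positivity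
  have hden : ∀ ψ, 0 < rateDen m ψ (exp (u ψ) ^ 3) := fun ψ =>
    one_half_pos.trans_le (half_le_rateDen hm0 hm1 (hz0 ψ) (hz ψ) ψ)
  have huc : Continuous u := continuous_iff_continuousAt.2 fun ψ => (hu ψ).continuousAt
  have hper2 : Function.Periodic u (2 * π) := by simpa using hper.nat_mul 2
  have hτ : ∀ ψ, 1 / 3 ≤ timeRate m (u ψ) ψ := by
    intro ψ
    have h1 := rateDen_le hm0 hm1 (hz0 ψ) (hz ψ) ψ
    have h2 : exp (u ψ) ≤ 1 := exp_le_one_iff.2 (by linarith [huU ψ])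
    rw [timeRate, le_div_iff₀ (mul_pos (exp_pos _) (hden ψ))]
    nlinarith [hden ψ, exp_pos (u ψ), sq_nonneg (sin ψ)]
  have hτc : Continuous fun ψ => timeRate m (u ψ) ψ := by
    refine Continuous.div (by fun_prop) ?_ fun ψ => (mul_pos (exp_pos _) (hden ψ)).ne'
    unfold rateDen
    fun_prop
  obtain ⟨γ, T, hγ, hT, hγT, hrange⟩ := exists_reparametrization (X := bacciotti m)
    (c := fun ψ => quasiPolar (u ψ) ψ) two_pi_pos (by norm_num) hτ hτc
    (fun ψ => by simp only [timeRate, rateDen, hper2 ψ, sin_add_two_pi, cos_add_two_pi])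
    (fun ψ => by simp only [hper2 ψ, quasiPolar_add_two_pi])
    (fun ψ => hasDerivAt_quasiPolar (hden ψ).ne' (hu ψ))
  refine ⟨γ, T, ⟨hγ, ?_, hT, hγT⟩, hrange.le⟩
  rintro ⟨q, hq⟩
  have hmem : ∀ ψ, quasiPolar (u ψ) ψ = q := by
    intro ψ
    obtain ⟨t, ht⟩ : quasiPolar (u ψ) ψ ∈ range γ := hrange ▸ mem_range_self ψ
    rw [← ht, hq]
  have h := congrArg Prod.snd ((hmem 0).trans (hmem π).symm)
  simp only [quasiPolar, cos_zero, cos_pi] at h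
  linarith [exp_pos (u 0), exp_pos (u π)]

theorem exists_isPeriodicOrbit_of_bracket {m U a b : ℝ} (hm0 : 0 ≤ m) (hm1 : m ≤ 1)
    (hU : U ≤ -1) (hab : a ≤ b) (hbU : b ≤ U - 4 * π)
    (hin : ∀ u : ℝ → ℝ, u 0 = a → (∀ ψ ∈ Icc 0 π, |u ψ - a| ≤ 4 * π) →
      (∀ ψ ∈ Icc 0 π,
        HasDerivAt u (rateNum m ψ (exp (u ψ) ^ 3) / rateDen m ψ (exp (u ψ) ^ 3)) ψ) → u π ≤ a)
    (hout : ∀ u : ℝ → ℝ, u 0 = b → (∀ ψ ∈ Icc 0 π, |u ψ - b| ≤ 4 * π) →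
      (∀ ψ ∈ Icc 0 π,
        HasDerivAt u (rateNum m ψ (exp (u ψ) ^ 3) / rateDen m ψ (exp (u ψ) ^ 3)) ψ) → b ≤ u π) :
    ∃ γ T, IsPeriodicOrbit m γ T ∧
      ∀ t, ∃ u ≤ U, ∃ ψ, γ t = quasiPolar u ψ := by
  set z : ℝ → ℝ := fun u => exp (min u U) ^ 3 with hzdef
  have hz0 : ∀ u, 0 ≤ z u := fun u => by positivity
  have hz1 : ∀ u, z u ≤ 1 / 8 := fun u => exp_pow_three_le ((min_le_right _ _).trans hU)
  have hzU : ∀ u ≤ U, z u = exp u ^ 3 := fun u hu => by simp only [hzdef, min_eq_left hu]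
  set f : ℝ → ℝ → ℝ := fun ψ u => rateNum m ψ (z u) / rateDen m ψ (z u) with hfdef
  have hzL : ∀ u v, |z u - z v| ≤ 3 * |u - v| := by
    intro u v
    have e : ∀ w, z w = exp (3 * min w U) := fun w => by
      simp only [hzdef]
      rw [← exp_nat_mul]
      norm_num
    have h1 : min u U ≤ -1 := (min_le_right _ _).trans hU
    have h2 : min v U ≤ -1 := (min_le_right _ _).trans hU
    have h3 : |min u U - min v U| ≤ |u - v| := by
      simpa [Real.dist_eq] using (LipschitzWith.id.min_const U).dist_le_mul u v
    rw [e, e]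
    refine (abs_exp_sub_exp_le (by linarith) (by linarith)).trans ?_
    rw [← mul_sub, abs_mul, abs_of_pos (by norm_num : (0 : ℝ) < 3)]
    linarith
  have hfL : ∀ ψ, LipschitzWith 60 (f ψ) := fun ψ => LipschitzWith.of_dist_le_mul fun u v => by
    rw [Real.dist_eq, Real.dist_eq]
    refine (abs_rate_sub_rate_le hm0 hm1 (hz0 u) (hz1 u) (hz0 v) (hz1 v) ψ).trans ?_
    push_cast
    linarith [hzL u v]
  have hfb : ∀ ψ u, |f ψ u| ≤ 4 := fun ψ u => abs_rate_le hm0 hm1 (hz0 u) (hz1 u) ψ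
  have hfc : ∀ u, Continuous fun ψ => f ψ u := by
    intro u
    refine Continuous.div (by unfold rateNum; fun_prop) (by unfold rateDen; fun_prop) fun ψ => ?_
    exact (one_half_pos.trans_le (half_le_rateDen hm0 hm1 (hz0 u) (hz1 u) ψ)).ne'
  choose Φ hΦ0 hΦ using fun a => exists_global_solution (L := 4) hfL hfc
    (fun ψ u => by simpa using hfb ψ u) a
  have hΦb : ∀ a, ∀ ψ ∈ Icc 0 π, |Φ a ψ - a| ≤ 4 * π := by
    intro a ψ hψ
    have h := Convex.norm_image_sub_le_of_norm_hasDerivWithin_le (C := 4)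
      (fun s _ => (hΦ a s).hasDerivWithinAt) (fun s _ => hfb s (Φ a s)) convex_univ
      (mem_univ 0) (mem_univ ψ)
    rw [hΦ0, Real.norm_eq_abs, Real.norm_eq_abs, sub_zero, abs_of_nonneg hψ.1] at h
    linarith [hψ.2]
  have hΦcont : ∀ a, Continuous (Φ a) := fun a =>
    continuous_iff_continuousAt.2 fun ψ => (hΦ a ψ).continuousAt
  have hret : Continuous fun a => Φ a π := by
    have hL : LipschitzWith (exp (60 * π)).toNNReal fun a => Φ a π := by
      refine LipschitzWith.of_dist_le_mul fun a b => ?_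
      have h := dist_le_of_trajectories_ODE hfL (hΦcont a).continuousOn
        (fun s _ => (hΦ a s).hasDerivWithinAt) (hΦcont b).continuousOn
        (fun s _ => (hΦ b s).hasDerivWithinAt) (le_of_eq (by rw [hΦ0, hΦ0])) π
        (right_mem_Icc.2 pi_pos.le)
      rw [Real.coe_toNNReal _ (exp_pos _).le]
      simpa [mul_comm] using h
    exact hL.continuous
  have hle : ∀ a ≤ U - 4 * π, ∀ ψ ∈ Icc 0 π, Φ a ψ ≤ U := fun a ha ψ hψ => by
    linarith [(abs_le.1 (hΦb a ψ hψ)).2]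
  have hΦ' : ∀ a ≤ U - 4 * π, ∀ ψ ∈ Icc 0 π, HasDerivAt (Φ a)
      (rateNum m ψ (exp (Φ a ψ) ^ 3) / rateDen m ψ (exp (Φ a ψ) ^ 3)) ψ := by
    intro a ha ψ hψ
    have h := hΦ a ψ
    simp only [hfdef, hzU _ (hle a ha ψ hψ)] at h
    exact h
  have h0 : (0 : ℝ) ∈ Icc (Φ a π - a) (Φ b π - b) :=
    ⟨sub_nonpos.2 (hin (Φ a) (hΦ0 a) (hΦb a) (hΦ' a (hab.trans hbU))),
      sub_nonneg.2 (hout (Φ b) (hΦ0 b) (hΦb b) (hΦ' b hbU))⟩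
  obtain ⟨u₀, hu₀, hfix⟩ := intermediate_value_Icc hab (hret.sub continuous_id).continuousOn h0
  have hu₀U : u₀ ≤ U - 4 * π := hu₀.2.trans hbU
  have hfix' : Φ u₀ π = Φ u₀ 0 := by
    rw [hΦ0]
    exact sub_eq_zero.1 hfix
  have hper : Function.Periodic (Φ u₀) π := by
    have hshift : ∀ ψ, HasDerivAt (fun s => Φ u₀ (s + π)) (f ψ (Φ u₀ (ψ + π))) ψ := by
      intro ψ
      have h := (hΦ u₀ (ψ + π)).comp_add_const ψ π
      simp only [hfdef, rate_add_pi] at h ⊢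
      exact h
    exact congrFun (ODE_solution_unique_univ (v := f) (s := fun _ => univ) (t₀ := 0)
      (fun ψ => (hfL ψ).lipschitzOnWith) (fun ψ => ⟨hshift ψ, trivial⟩)
      (fun ψ => ⟨hΦ u₀ ψ, trivial⟩) (by simpa using hfix'))
  have huU : ∀ ψ, Φ u₀ ψ ≤ U := by
    intro ψ
    obtain ⟨s, hs, hψs⟩ := hper.exists_mem_Ico₀ pi_pos ψ
    rw [hψs]
    exact hle u₀ hu₀U s ⟨hs.1, hs.2.le⟩
  obtain ⟨γ, T, hγ, hrange⟩ := exists_isPeriodicOrbit_of_periodic hm0 hm1 hU huU hper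
    fun ψ => by
      have h := hΦ u₀ ψ
      simp only [hfdef, hzU _ (huU ψ)] at h
      exact h
  refine ⟨γ, T, hγ, fun t => ?_⟩
  obtain ⟨ψ, hψ⟩ := hrange (mem_range_self t)
  exact ⟨Φ u₀ ψ, huU ψ, ψ, hψ.symm⟩

theorem quasiPolar_zero (u : ℝ) : quasiPolar u 0 = (0, exp u) := by
  simp [quasiPolar]

theorem quasiPolar_pi (u : ℝ) : quasiPolar u π = (0, -exp u) := by
  simp [quasiPolar]

theorem quasiPolar_ne_zero (u ψ : ℝ) : quasiPolar u ψ ≠ 0 := by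
  intro h
  simp only [quasiPolar, Prod.mk_eq_zero, mul_eq_zero, (exp_pos u).ne', ne_eq,
    OfNat.ofNat_ne_zero, not_false_eq_true, pow_eq_zero_iff, false_or] at h
  have := sin_sq_add_cos_sq ψ
  rw [h.1, h.2] at this
  norm_num at this

theorem abs_quasiPolar_fst_le {u : ℝ} (hu : u ≤ 0) (ψ : ℝ) : |(quasiPolar u ψ).1| ≤ exp u := by
  rw [quasiPolar, abs_mul, abs_of_pos (by positivity : 0 < exp u ^ 2)]
  have h1 := exp_le_one_iff.2 hu
  have h2 := abs_sin_le_one ψ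
  have h3 : exp u ^ 2 ≤ exp u := by nlinarith [exp_pos u]
  nlinarith [abs_nonneg (sin ψ), exp_pos u, sq_nonneg (exp u)]

theorem abs_quasiPolar_snd_le (u ψ : ℝ) : |(quasiPolar u ψ).2| ≤ exp u := by
  rw [quasiPolar, abs_mul, abs_of_pos (exp_pos u)]
  nlinarith [abs_cos_le_one ψ, exp_pos u]

/-- Monotonicity, over half a turn, of a function whose derivative along the vector field is
nonnegative. -/
theorem le_of_forall_nonneg_along_quasiPolar {m : ℝ} (hm0 : 0 ≤ m) (hm1 : m ≤ 1)
    {W W₁ W₂ : ℝ × ℝ → ℝ} {u : ℝ → ℝ}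
    (hW : ∀ (γ : ℝ → ℝ × ℝ) (v : ℝ × ℝ) (s : Set ℝ) (t : ℝ), HasDerivWithinAt γ v s t →
      HasDerivWithinAt (fun r => W (γ r)) (W₁ (γ t) * v.1 + W₂ (γ t) * v.2) s t)
    (hu : ∀ ψ ∈ Icc 0 π, u ψ ≤ -1)
    (hd : ∀ ψ ∈ Icc 0 π,
      HasDerivAt u (rateNum m ψ (exp (u ψ) ^ 3) / rateDen m ψ (exp (u ψ) ^ 3)) ψ)
    (hnonneg : ∀ ψ ∈ Icc 0 π, 0 ≤ W₁ (quasiPolar (u ψ) ψ) * (bacciotti m (quasiPolar (u ψ) ψ)).1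
      + W₂ (quasiPolar (u ψ) ψ) * (bacciotti m (quasiPolar (u ψ) ψ)).2) :
    W (0, exp (u 0)) ≤ W (0, -exp (u π)) := by
  have hden : ∀ ψ ∈ Icc 0 π, 0 < rateDen m ψ (exp (u ψ) ^ 3) := fun ψ hψ =>
    one_half_pos.trans_le (half_le_rateDen hm0 hm1 (by positivity) (exp_pow_three_le (hu ψ hψ)) ψ)
  have hcurve : ∀ ψ ∈ Icc 0 π, HasDerivWithinAt (fun s => W (quasiPolar (u s) s))
      (timeRate m (u ψ) ψ * (W₁ (quasiPolar (u ψ) ψ) * (bacciotti m (quasiPolar (u ψ) ψ)).1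
        + W₂ (quasiPolar (u ψ) ψ) * (bacciotti m (quasiPolar (u ψ) ψ)).2)) (Icc 0 π) ψ := by
    intro ψ hψ
    refine (hW _ _ _ _ (hasDerivAt_quasiPolar (hden ψ hψ).ne'
      (hd ψ hψ)).hasDerivWithinAt).congr_deriv ?_
    simp only [Prod.smul_fst, Prod.smul_snd, smul_eq_mul]
    ring
  have hmono : MonotoneOn (fun s => W (quasiPolar (u s) s)) (Icc 0 π) := by
    refine monotoneOn_of_hasDerivWithinAt_nonneg (convex_Icc 0 π)
      (fun ψ hψ => (hcurve ψ hψ).continuousWithinAt)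
      (fun ψ hψ => (hcurve ψ (interior_subset hψ)).mono interior_subset) fun ψ hψ => ?_
    have hψ' := interior_subset hψ
    exact mul_nonneg (div_nonneg (by positivity)
      (mul_pos (exp_pos _) (hden ψ hψ')).le) (hnonneg ψ hψ')
  have h := hmono (left_mem_Icc.2 pi_pos.le) (right_mem_Icc.2 pi_pos.le) pi_pos.le
  simpa only [quasiPolar_zero, quasiPolar_pi] using h

/-- A Lyapunov function for Bacciotti's system with parameter below `3/5`, with coefficients
`α`, `β`. -/
def innerLyap (α β : ℝ) (p : ℝ × ℝ) : ℝ :=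
  p.1 ^ 2 / 2 + p.2 ^ 4 / 4 - α * (p.1 ^ 3 * p.2) - β * (p.1 * p.2 ^ 5)

/-- The partial derivative of `innerLyap` in the first variable. -/
def innerLyapFst (α β : ℝ) (p : ℝ × ℝ) : ℝ :=
  p.1 - 3 * α * p.1 ^ 2 * p.2 - β * p.2 ^ 5

/-- The partial derivative of `innerLyap` in the second variable. -/
def innerLyapSnd (α β : ℝ) (p : ℝ × ℝ) : ℝ :=
  p.2 ^ 3 - α * p.1 ^ 3 - 5 * β * p.1 * p.2 ^ 4

theorem hasDerivWithinAt_innerLyap (α β : ℝ) {γ : ℝ → ℝ × ℝ} {v : ℝ × ℝ} {s : Set ℝ} {t : ℝ}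
    (h : HasDerivWithinAt γ v s t) :
    HasDerivWithinAt (fun u => innerLyap α β (γ u))
      (innerLyapFst α β (γ t) * v.1 + innerLyapSnd α β (γ t) * v.2) s t := by
  have hx : HasDerivWithinAt (fun u => (γ u).1) v.1 s t := h.fst
  have hy : HasDerivWithinAt (fun u => (γ u).2) v.2 s t := h.snd
  have := ((((hx.pow 2).div_const 2).add ((hy.pow 4).div_const 4)).sub
    (((hx.pow 3).mul hy).const_mul α)).sub ((hx.mul (hy.pow 5)).const_mul β)
  refine this.congr_deriv ?_
  simp only [innerLyapFst, innerLyapSnd, Pi.pow_apply]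
  push_cast
  ring

theorem innerLyap_dot_nonpos {m d : ℝ} (hm0 : 0 ≤ m) (hd : 0 < d) (hmd : 5 * m + 9 * d = 3)
    {p : ℝ × ℝ} (hp : |p.1 * p.2| ≤ d / 3) :
    innerLyapFst (1 - d) (m + d) p * (bacciotti m p).1
      + innerLyapSnd (1 - d) (m + d) p * (bacciotti m p).2 ≤ 0 := by
  obtain ⟨x, y⟩ := p
  simp only at hp
  obtain ⟨h1, h2⟩ := abs_le.1 hp
  have e : innerLyapFst (1 - d) (m + d) (x, y) * (bacciotti m (x, y)).1
      + innerLyapSnd (1 - d) (m + d) (x, y) * (bacciotti m (x, y)).2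
      = x ^ 4 * (-d + 3 * (1 - d) * (x * y)) + x ^ 2 * y ^ 4 * (-d + (d + m * d) * (x * y))
        + y ^ 8 * (-d - 5 * m * (m + d) * (x * y)) := by
    simp only [innerLyapFst, innerLyapSnd, bacciotti]
    linear_combination x ^ 2 * y ^ 4 * hmd
  have f1 : -d + 3 * (1 - d) * (x * y) ≤ 0 := by nlinarith
  have f2 : -d + (d + m * d) * (x * y) ≤ 0 := by nlinarith [mul_nonneg hm0 hd.le]
  have hm1 : 5 * m * (m + d) ≤ 3 := by nlinarith
  have hm2 : 0 ≤ 5 * m * (m + d) := by positivity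
  have f3 : -d - 5 * m * (m + d) * (x * y) ≤ 0 := by nlinarith
  rw [e]
  have g1 := mul_nonpos_of_nonneg_of_nonpos (by positivity : 0 ≤ x ^ 4) f1
  have g2 := mul_nonpos_of_nonneg_of_nonpos (by positivity : 0 ≤ x ^ 2 * y ^ 4) f2
  have g3 := mul_nonpos_of_nonneg_of_nonpos (by positivity : 0 ≤ y ^ 8) f3
  linarith

theorem lyapDot_eq (m : ℝ) (p : ℝ × ℝ) :
    lyapDot m p = lyapDot (3 / 5) p + (m - 3 / 5) * (p.2 ^ 5 * lyapSnd p) := by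
  simp only [lyapDot, bacciotti]
  ring

theorem IsCompact.exists_forall_nonneg_add_mul {X : Type*} [TopologicalSpace X] {K : Set X}
    (hK : IsCompact K) {f g : X → ℝ} (hf : ContinuousOn f K) (hg : ContinuousOn g K)
    (hpos : ∀ q ∈ K, 0 < f q) : ∃ ε > 0, ∀ s, |s| < ε → ∀ q ∈ K, 0 ≤ f q + s * g q := by
  rcases K.eq_empty_or_nonempty with rfl | hne
  · exact ⟨1, one_pos, fun s _ q hq => hq.elim⟩
  obtain ⟨q₀, hq₀, hmin⟩ := hK.exists_isMinOn hne hf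
  obtain ⟨C, hC⟩ := hK.exists_bound_of_continuousOn hg
  have hC0 : 0 < |C| + 1 := by positivity
  refine ⟨f q₀ / (|C| + 1), div_pos (hpos q₀ hq₀) hC0, fun s hs q hq => ?_⟩
  have h1 : f q₀ ≤ f q := hmin hq
  rw [lt_div_iff₀ hC0] at hs
  have h2 : |s * g q| ≤ f q₀ := by
    rw [abs_mul]
    refine le_trans ?_ hs.le
    gcongr
    exact (hC q hq).trans (by linarith [le_abs_self C])
  linarith [(abs_le.1 h2).1]

theorem exists_forall_lyapDot_quasiPolar_nonneg (A : ℝ) {U : ℝ} (hU : U ≤ 0)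
    (hU' : exp U ≤ 1 / 100) :
    ∃ ε > 0, ∀ m, |m - 3 / 5| < ε → ∀ u ∈ Icc A U, ∀ ψ ∈ Icc 0 π,
      0 ≤ lyapDot m (quasiPolar u ψ) := by
  have hq : Continuous fun q : ℝ × ℝ => quasiPolar q.1 q.2 := by
    unfold quasiPolar
    fun_prop
  have hg : Continuous fun p : ℝ × ℝ => p.2 ^ 5 * lyapSnd p := by
    unfold lyapSnd
    fun_prop
  obtain ⟨ε, hε, h⟩ := IsCompact.exists_forall_nonneg_add_mul
    ((isCompact_Icc (a := A) (b := U)).prod (isCompact_Icc (a := 0) (b := π)))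
    ((continuous_lyapDot (3 / 5)).comp hq).continuousOn (hg.comp hq).continuousOn
    fun q hq => by
      have h := exp_le_exp.2 hq.1.2
      exact lyapDot_pos (quasiPolar_ne_zero _ _)
        ((abs_quasiPolar_fst_le (hq.1.2.trans hU) _).trans (h.trans hU'))
        ((abs_quasiPolar_snd_le _ _).trans (h.trans hU'))
  refine ⟨ε, hε, fun m hm u hu ψ hψ => ?_⟩
  rw [lyapDot_eq]
  exact h _ hm (u, ψ) (mk_mem_prod hu hψ)

theorem exists_isPeriodicOrbit_of_lt {m U : ℝ} (hU : U ≤ -1)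
    (hdot : ∀ u ∈ Icc (U - 8 * π) U, ∀ ψ ∈ Icc 0 π, 0 ≤ lyapDot m (quasiPolar u ψ))
    (hm0 : 0 ≤ m) (hm : m < 3 / 5) :
    ∃ γ T, IsPeriodicOrbit m γ T ∧ ∀ t, ∃ u ≤ U, ∃ ψ, γ t = quasiPolar u ψ := by
  have hm1 : m ≤ 1 := by linarith
  obtain ⟨d, hmd⟩ : ∃ d, 5 * m + 9 * d = 3 := ⟨(3 - 5 * m) / 9, by ring⟩
  have hd : 0 < d := by linarith
  refine exists_isPeriodicOrbit_of_bracket hm0 hm1 hU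
    (a := min (U - 4 * π) (log (d / 3) - 4 * π)) (b := U - 4 * π) (min_le_left _ _) le_rfl ?_ ?_
  · intro u hu0 hu hder
    have hle : ∀ ψ ∈ Icc 0 π, u ψ ≤ U ∧ u ψ ≤ log (d / 3) := by
      intro ψ hψ
      have h := (abs_le.1 (hu ψ hψ)).2
      constructor
      · linarith [min_le_left (U - 4 * π) (log (d / 3) - 4 * π)]
      · linarith [min_le_right (U - 4 * π) (log (d / 3) - 4 * π)]
    have h := le_of_forall_nonneg_along_quasiPolar hm0 hm1
      (W := fun p => -innerLyap (1 - d) (m + d) p) (W₁ := fun p => -innerLyapFst (1 - d) (m + d) p)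
      (W₂ := fun p => -innerLyapSnd (1 - d) (m + d) p) (u := u)
      (fun γ v s t hγ => (hasDerivWithinAt_innerLyap _ _ hγ).neg.congr_deriv (by ring))
      (fun ψ hψ => (hle ψ hψ).1.trans hU) hder ?_
    · simp only [innerLyap] at h
      have h4 : exp (u π) ^ 4 ≤ exp (u 0) ^ 4 := by linarith
      rw [← hu0]
      exact exp_le_exp.1 (le_of_pow_le_pow_left₀ (by norm_num) (exp_pos _).le h4)
    · intro ψ hψ
      have hx := abs_quasiPolar_fst_le (by linarith [(hle ψ hψ).1]) ψ (u := u ψ)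
      have hy := abs_quasiPolar_snd_le (u ψ) ψ
      have h1 : exp (u ψ) ≤ 1 := exp_le_one_iff.2 (by linarith [(hle ψ hψ).1])
      have h2 : exp (u ψ) ≤ d / 3 := by
        rw [← exp_log (by positivity : 0 < d / 3)]
        exact exp_le_exp.2 (hle ψ hψ).2
      have h3 : |(quasiPolar (u ψ) ψ).1 * (quasiPolar (u ψ) ψ).2| ≤ d / 3 := by
        rw [abs_mul]
        nlinarith [abs_nonneg (quasiPolar (u ψ) ψ).1, abs_nonneg (quasiPolar (u ψ) ψ).2]
      linarith [innerLyap_dot_nonpos hm0 hd hmd h3]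
  · intro u hu0 hu hder
    have hmem : ∀ ψ ∈ Icc 0 π, u ψ ∈ Icc (U - 8 * π) U := by
      intro ψ hψ
      have h := abs_le.1 (hu ψ hψ)
      constructor <;> linarith
    have h := le_of_forall_nonneg_along_quasiPolar hm0 hm1 (W := lyap) (W₁ := lyapFst)
      (W₂ := lyapSnd) (u := u) (fun γ v s t hγ => hasDerivWithinAt_lyap hγ)
      (fun ψ hψ => (hmem ψ hψ).2.trans hU) hder (fun ψ hψ => hdot _ (hmem ψ hψ) ψ hψ)
    simp only [lyap] at h
    rw [← hu0]
    by_contra! hlt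
    have hlt' := exp_lt_exp.2 hlt
    have h4 : exp (u π) ^ 4 < exp (u 0) ^ 4 := by gcongr
    have h10 : exp (u π) ^ 10 < exp (u 0) ^ 10 := by gcongr
    have e4 : (-exp (u π)) ^ 4 = exp (u π) ^ 4 := by ring
    have e10 : (-exp (u π)) ^ 10 = exp (u π) ^ 10 := by ring
    rw [e4, e10] at h
    linarith

theorem bacciotti_hopf_at_three_fifths :
    OriginIsRepeller (bacciotti (3 / 5)) ∧
    ∀ U ∈ nhds ((0, 0) : ℝ × ℝ), ∃ ε > (0 : ℝ),
      ∀ m : ℝ, 3 / 5 - ε < m → m < 3 / 5 →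
        ∃ (γ : ℝ → ℝ × ℝ) (T : ℝ), IsPeriodicOrbit m γ T ∧ Set.range γ ⊆ U := by
  refine ⟨originIsRepeller_bacciotti, fun N hN => ?_⟩
  obtain ⟨δ, hδ, hball⟩ := Metric.mem_nhds_iff.1 hN
  have hr : 0 < min (δ / 2) (1 / 100) := by positivity
  obtain ⟨U, hU1, hUr⟩ : ∃ U : ℝ, U ≤ -1 ∧ exp U ≤ min (δ / 2) (1 / 100) :=
    ⟨min (-1) (log (min (δ / 2) (1 / 100))), min_le_left _ _,
      (exp_le_exp.2 (min_le_right _ _)).trans (exp_log hr).le⟩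
  obtain ⟨ε, hε, hdot⟩ := exists_forall_lyapDot_quasiPolar_nonneg (U - 8 * π) (by linarith)
    (hUr.trans (min_le_right _ _))
  refine ⟨min ε (3 / 5), by positivity, fun m hm1 hm2 => ?_⟩
  have hmε : |m - 3 / 5| < ε := by
    rw [abs_lt]
    constructor <;> linarith [min_le_left ε (3 / 5)]
  obtain ⟨γ, T, hγ, hγU⟩ := exists_isPeriodicOrbit_of_lt hU1 (hdot m hmε)
    (by linarith [min_le_right ε (3 / 5)]) hm2
  refine ⟨γ, T, hγ, ?_⟩
  rintro _ ⟨t, rfl⟩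
  obtain ⟨u, hu, ψ, hψ⟩ := hγU t
  refine hball ?_
  have hexp : exp u < δ := by
    linarith [exp_le_exp.2 hu, hUr.trans (min_le_left _ _)]
  rw [hψ, Metric.mem_ball, ← Prod.zero_eq_mk, dist_zero_right, Prod.norm_def]
  exact max_lt ((abs_quasiPolar_fst_le (by linarith) _).trans_lt hexp)
    ((abs_quasiPolar_snd_le _ _).trans_lt hexp)

end
end
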